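/- The vector space U⁺ is spanned over ℂ by the ordered monomials ∏→_{β∈Δ} (∏_{i=1}^{c_β} X_β(n_{i,β})), where c_β ∈ ℤ_{≥0} for each β ∈ Δ, n_{i,β} ∈ ℤ for 1 ≤ i ≤ c_β, and the factors appear in increasing order of β ∈ Δ (Poincaré–Birkhoff–Witt spanning property in terms of Drinfel'd root vectors). -/

import Mathlib

noncomputable section

namespace QAS

open Polynomial
open scoped TensorProduct

/-! ### Basic combinatorial data -/

/-- `l_i = 1` for `i ≤ M`, `-1` otherwise. -/
def lof (M : ℕ) (i : ℕ) : ℤ := if i ≤ M then 1 else -1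

/-- the bilinear form `(ε_i, ε_j) = l_i δ_{ij}`. -/
def innerE (M : ℕ) (i j : ℕ) : ℤ := if i = j then lof M i else 0

/-- `(ε_a − ε_b, ε_c − ε_d)`. -/
def form4 (M : ℕ) (a b c d : ℕ) : ℤ :=
  innerE M a c - innerE M a d - innerE M b c + innerE M b d

/-- the Cartan pairing `c_{ij} = (ε_i − ε_{i+1}, ε_j − ε_{j+1})`. -/
def cc (M : ℕ) (i j : ℕ) : ℤ := form4 M i (i + 1) j (j + 1)

/-- `q_i = q^{l_i}`. -/
def qpar (q : ℂ) (M : ℕ) (i : ℕ) : ℂ := q ^ lof M i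

/-- the quantum integer `[m]_v`. -/
def qint (v : ℂ) (m : ℤ) : ℂ := (v ^ m - v ^ (-m)) / (v - v⁻¹)

/-- the sign `(−1)^{|X_i||X_j|}` for the generators `X_i`, `X_j`. -/
def sgn (M : ℕ) (i j : ℕ) : ℂ := if i = M ∧ j = M then -1 else 1

/-- index set `1 ≤ i ≤ M+N−1`. -/
abbrev Idx (M N : ℕ) := {i : ℕ // 1 ≤ i ∧ i ≤ M + N - 1}

/-! ### Generators and the free superalgebra -/

/-- Drinfel'd generators; when `ext = true` we also have `K₀^{±1}`. -/
inductive Gen (M N : ℕ) (ext : Bool) : Type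
  | Xp : Idx M N → ℤ → Gen M N ext
  | Xm : Idx M N → ℤ → Gen M N ext
  | K : Idx M N → Gen M N ext
  | Ki : Idx M N → Gen M N ext
  | H : Idx M N → {s : ℤ // s ≠ 0} → Gen M N ext
  | K0 : ext = true → Gen M N ext
  | K0i : ext = true → Gen M N ext

abbrev FA (M N : ℕ) (ext : Bool) := FreeAlgebra ℂ (Gen M N ext)

def gi {M N : ℕ} {ext : Bool} (g : Gen M N ext) : FA M N ext := FreeAlgebra.ι ℂ g

def XpF (M N : ℕ) (ext : Bool) (i : ℕ) (n : ℤ) : FA M N ext :=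
  if h : 1 ≤ i ∧ i ≤ M + N - 1 then gi (Gen.Xp ⟨i, h⟩ n) else 0

def XmF (M N : ℕ) (ext : Bool) (i : ℕ) (n : ℤ) : FA M N ext :=
  if h : 1 ≤ i ∧ i ≤ M + N - 1 then gi (Gen.Xm ⟨i, h⟩ n) else 0

def KF (M N : ℕ) (ext : Bool) (i : ℕ) : FA M N ext :=
  if h : 1 ≤ i ∧ i ≤ M + N - 1 then gi (Gen.K ⟨i, h⟩) else 0

def KiF (M N : ℕ) (ext : Bool) (i : ℕ) : FA M N ext :=
  if h : 1 ≤ i ∧ i ≤ M + N - 1 then gi (Gen.Ki ⟨i, h⟩) else 0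

def HF (M N : ℕ) (ext : Bool) (i : ℕ) (s : ℤ) : FA M N ext :=
  if h : (1 ≤ i ∧ i ≤ M + N - 1) ∧ s ≠ 0 then gi (Gen.H ⟨i, h.1⟩ ⟨s, h.2⟩) else 0

def K0F (M N : ℕ) (ext : Bool) : FA M N ext :=
  if h : ext = true then gi (Gen.K0 h) else 0

def K0iF (M N : ℕ) (ext : Bool) : FA M N ext :=
  if h : ext = true then gi (Gen.K0i h) else 0

/-- coefficients of `exp (t · Σ_{s ≥ 1} a_s z^s)`. -/
def expC {A : Type} [Ring A] [Algebra ℂ A] (t : ℂ) (a : ℕ → A) : ℕ → A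
  | 0 => 1
  | n + 1 =>
      ((n : ℂ) + 1)⁻¹ •
        (t • ∑ s ∈ Finset.range (n + 1), ((s : ℂ) + 1) • (a (s + 1) * expC t a (n - s)))
termination_by n => n
decreasing_by omega

/-- `φ⁺_{i,n}`, the coefficient of `z^n` in
`K_i exp((q_i − q_i⁻¹) Σ_{s>0} h_{i,s} z^s)`. -/
def phiPF (q : ℂ) (M N : ℕ) (ext : Bool) (i : ℕ) (n : ℤ) : FA M N ext :=
  if 0 ≤ n then
    KF M N ext i *
      expC (qpar q M i - (qpar q M i)⁻¹) (fun s => HF M N ext i (s : ℤ)) n.toNat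
  else 0

/-- `φ⁻_{i,n}`, the coefficient of `z^n` (`n ≤ 0`) in
`K_i⁻¹ exp(−(q_i − q_i⁻¹) Σ_{s>0} h_{i,−s} z^{−s})`. -/
def phiMF (q : ℂ) (M N : ℕ) (ext : Bool) (i : ℕ) (n : ℤ) : FA M N ext :=
  if n ≤ 0 then
    KiF M N ext i *
      expC (-(qpar q M i - (qpar q M i)⁻¹)) (fun s => HF M N ext i (-(s : ℤ))) (-n).toNat
  else 0

/-- the `u`-bracket `[x,y]_u = xy − u·yx` (for `x` or `y` of even parity). -/
def brF {A : Type} [Ring A] [Module ℂ A] (u : ℂ) (x y : A) : A := x * y - u • (y * x)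

/-- the quartic oscillation expression
`[[[X_{M−1,m}, X_{M,n}]_{q⁻¹}, X_{M+1,k}]_q, X_{M,u}]` (a graded anticommutator in the
outermost bracket, both entries being odd). -/
def oscOf {A : Type} [Ring A] [Module ℂ A] (q : ℂ) (M : ℕ) (X : ℕ → ℤ → A) (m n k u : ℤ) : A :=
  brF q (brF q⁻¹ (X (M - 1) m) (X M n)) (X (M + 1) k) * X M u +
    X M u * brF q (brF q⁻¹ (X (M - 1) m) (X M n)) (X (M + 1) k)

/-! ### The defining relations.
`lvl = 1`: only (R1)–(R3);  `lvl = 2`: (R1)–(R5);  `lvl = 3`: all of (R1)–(R7).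
`ext = true` adds `K₀^{±1}` together with its relations. -/

inductive rel (q : ℂ) (M N : ℕ) (ext : Bool) (lvl : ℕ) : FA M N ext → FA M N ext → Prop
  | KKi (i : Idx M N) : rel q M N ext lvl (gi (Gen.K i) * gi (Gen.Ki i)) 1
  | KiK (i : Idx M N) : rel q M N ext lvl (gi (Gen.Ki i) * gi (Gen.K i)) 1
  | KK (i j : Idx M N) :
      rel q M N ext lvl (gi (Gen.K i) * gi (Gen.K j)) (gi (Gen.K j) * gi (Gen.K i))
  | KKi2 (i j : Idx M N) :
      rel q M N ext lvl (gi (Gen.K i) * gi (Gen.Ki j)) (gi (Gen.Ki j) * gi (Gen.K i))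
  | KiKi (i j : Idx M N) :
      rel q M N ext lvl (gi (Gen.Ki i) * gi (Gen.Ki j)) (gi (Gen.Ki j) * gi (Gen.Ki i))
  | KH (i j : Idx M N) (s : {s : ℤ // s ≠ 0}) :
      rel q M N ext lvl (gi (Gen.K i) * gi (Gen.H j s)) (gi (Gen.H j s) * gi (Gen.K i))
  | KiH (i j : Idx M N) (s : {s : ℤ // s ≠ 0}) :
      rel q M N ext lvl (gi (Gen.Ki i) * gi (Gen.H j s)) (gi (Gen.H j s) * gi (Gen.Ki i))
  | HH (i j : Idx M N) (s t : {s : ℤ // s ≠ 0}) :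
      rel q M N ext lvl (gi (Gen.H i s) * gi (Gen.H j t)) (gi (Gen.H j t) * gi (Gen.H i s))
  | KXp (i j : Idx M N) (n : ℤ) :
      rel q M N ext lvl (gi (Gen.K i) * gi (Gen.Xp j n))
        ((q ^ cc M i.1 j.1) • (gi (Gen.Xp j n) * gi (Gen.K i)))
  | KXm (i j : Idx M N) (n : ℤ) :
      rel q M N ext lvl (gi (Gen.K i) * gi (Gen.Xm j n))
        ((q ^ (-cc M i.1 j.1)) • (gi (Gen.Xm j n) * gi (Gen.K i)))
  | HXp (i j : Idx M N) (s : {s : ℤ // s ≠ 0}) (n : ℤ) :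
      rel q M N ext lvl
        (gi (Gen.H i s) * gi (Gen.Xp j n) - gi (Gen.Xp j n) * gi (Gen.H i s))
        ((qint (qpar q M i.1) (s.1 * lof M i.1 * cc M i.1 j.1) / (s.1 : ℂ)) •
          gi (Gen.Xp j (n + s.1)))
  | HXm (i j : Idx M N) (s : {s : ℤ // s ≠ 0}) (n : ℤ) :
      rel q M N ext lvl
        (gi (Gen.H i s) * gi (Gen.Xm j n) - gi (Gen.Xm j n) * gi (Gen.H i s))
        (-((qint (qpar q M i.1) (s.1 * lof M i.1 * cc M i.1 j.1) / (s.1 : ℂ)) •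
          gi (Gen.Xm j (n + s.1))))
  | XpXm (i j : Idx M N) (m n : ℤ) :
      rel q M N ext lvl
        (gi (Gen.Xp i m) * gi (Gen.Xm j n) -
          sgn M i.1 j.1 • (gi (Gen.Xm j n) * gi (Gen.Xp i m)))
        (if i = j then
            (qpar q M i.1 - (qpar q M i.1)⁻¹)⁻¹ •
              (phiPF q M N ext i.1 (m + n) - phiMF q M N ext i.1 (m + n))
          else 0)
  | XX0p (i j : Idx M N) (m n : ℤ) (h2 : 2 ≤ lvl) (h : cc M i.1 j.1 = 0) :
      rel q M N ext lvl
        (gi (Gen.Xp i m) * gi (Gen.Xp j n) -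
          sgn M i.1 j.1 • (gi (Gen.Xp j n) * gi (Gen.Xp i m))) 0
  | XX0m (i j : Idx M N) (m n : ℤ) (h2 : 2 ≤ lvl) (h : cc M i.1 j.1 = 0) :
      rel q M N ext lvl
        (gi (Gen.Xm i m) * gi (Gen.Xm j n) -
          sgn M i.1 j.1 • (gi (Gen.Xm j n) * gi (Gen.Xm i m))) 0
  | XXp (i j : Idx M N) (m n : ℤ) (h2 : 2 ≤ lvl) (h : cc M i.1 j.1 ≠ 0) :
      rel q M N ext lvl
        (gi (Gen.Xp i (m + 1)) * gi (Gen.Xp j n) -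
          (q ^ cc M i.1 j.1) • (gi (Gen.Xp j n) * gi (Gen.Xp i (m + 1))))
        ((q ^ cc M i.1 j.1) • (gi (Gen.Xp i m) * gi (Gen.Xp j (n + 1))) -
          gi (Gen.Xp j (n + 1)) * gi (Gen.Xp i m))
  | XXm (i j : Idx M N) (m n : ℤ) (h2 : 2 ≤ lvl) (h : cc M i.1 j.1 ≠ 0) :
      rel q M N ext lvl
        (gi (Gen.Xm i (m + 1)) * gi (Gen.Xm j n) -
          (q ^ (-cc M i.1 j.1)) • (gi (Gen.Xm j n) * gi (Gen.Xm i (m + 1))))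
        ((q ^ (-cc M i.1 j.1)) • (gi (Gen.Xm i m) * gi (Gen.Xm j (n + 1))) -
          gi (Gen.Xm j (n + 1)) * gi (Gen.Xm i m))
  | serreP (i j : Idx M N) (m n k : ℤ) (h3 : 3 ≤ lvl)
      (h : cc M i.1 j.1 = 1 ∨ cc M i.1 j.1 = -1) (hi : i.1 ≠ M) :
      rel q M N ext lvl
        (brF q (gi (Gen.Xp i m)) (brF q⁻¹ (gi (Gen.Xp i n)) (gi (Gen.Xp j k))) +
          brF q (gi (Gen.Xp i n)) (brF q⁻¹ (gi (Gen.Xp i m)) (gi (Gen.Xp j k)))) 0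
  | serreM (i j : Idx M N) (m n k : ℤ) (h3 : 3 ≤ lvl)
      (h : cc M i.1 j.1 = 1 ∨ cc M i.1 j.1 = -1) (hi : i.1 ≠ M) :
      rel q M N ext lvl
        (brF q (gi (Gen.Xm i m)) (brF q⁻¹ (gi (Gen.Xm i n)) (gi (Gen.Xm j k))) +
          brF q (gi (Gen.Xm i n)) (brF q⁻¹ (gi (Gen.Xm i m)) (gi (Gen.Xm j k)))) 0
  | oscP (m n k u : ℤ) (h3 : 3 ≤ lvl) (hM : 1 < M) (hN : 1 < N) :
      rel q M N ext lvl
        (oscOf q M (XpF M N ext) m n k u + oscOf q M (XpF M N ext) m u k n) 0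
  | oscM (m n k u : ℤ) (h3 : 3 ≤ lvl) (hM : 1 < M) (hN : 1 < N) :
      rel q M N ext lvl
        (oscOf q M (XmF M N ext) m n k u + oscOf q M (XmF M N ext) m u k n) 0
  | K0K0i (he : ext = true) : rel q M N ext lvl (gi (Gen.K0 he) * gi (Gen.K0i he)) 1
  | K0iK0 (he : ext = true) : rel q M N ext lvl (gi (Gen.K0i he) * gi (Gen.K0 he)) 1
  | K0K (he : ext = true) (i : Idx M N) :
      rel q M N ext lvl (gi (Gen.K0 he) * gi (Gen.K i)) (gi (Gen.K i) * gi (Gen.K0 he))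
  | K0Ki (he : ext = true) (i : Idx M N) :
      rel q M N ext lvl (gi (Gen.K0 he) * gi (Gen.Ki i)) (gi (Gen.Ki i) * gi (Gen.K0 he))
  | K0H (he : ext = true) (i : Idx M N) (s : {s : ℤ // s ≠ 0}) :
      rel q M N ext lvl (gi (Gen.K0 he) * gi (Gen.H i s)) (gi (Gen.H i s) * gi (Gen.K0 he))
  | K0Xp (he : ext = true) (i : Idx M N) (n : ℤ) :
      rel q M N ext lvl (gi (Gen.K0 he) * gi (Gen.Xp i n))
        ((q ^ (if i.1 = 1 then (1 : ℤ) else 0)) • (gi (Gen.Xp i n) * gi (Gen.K0 he)))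
  | K0Xm (he : ext = true) (i : Idx M N) (n : ℤ) :
      rel q M N ext lvl (gi (Gen.K0 he) * gi (Gen.Xm i n))
        ((q ^ (if i.1 = 1 then (-1 : ℤ) else 0)) • (gi (Gen.Xm i n) * gi (Gen.K0 he)))

/-! ### The quantum affine superalgebras -/

abbrev ALG (q : ℂ) (M N : ℕ) (ext : Bool) (lvl : ℕ) := RingQuot (rel q M N ext lvl)

def mkA (q : ℂ) (M N : ℕ) (ext : Bool) (lvl : ℕ) : FA M N ext →ₐ[ℂ] ALG q M N ext lvl :=
  RingQuot.mkAlgHom ℂ (rel q M N ext lvl)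

def XpA (q : ℂ) (M N : ℕ) (ext : Bool) (lvl : ℕ) (i : ℕ) (n : ℤ) : ALG q M N ext lvl :=
  mkA q M N ext lvl (XpF M N ext i n)

def XmA (q : ℂ) (M N : ℕ) (ext : Bool) (lvl : ℕ) (i : ℕ) (n : ℤ) : ALG q M N ext lvl :=
  mkA q M N ext lvl (XmF M N ext i n)

def KA (q : ℂ) (M N : ℕ) (ext : Bool) (lvl : ℕ) (i : ℕ) : ALG q M N ext lvl :=
  mkA q M N ext lvl (KF M N ext i)

def KiA (q : ℂ) (M N : ℕ) (ext : Bool) (lvl : ℕ) (i : ℕ) : ALG q M N ext lvl :=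
  mkA q M N ext lvl (KiF M N ext i)

def HA (q : ℂ) (M N : ℕ) (ext : Bool) (lvl : ℕ) (i : ℕ) (s : ℤ) : ALG q M N ext lvl :=
  mkA q M N ext lvl (HF M N ext i s)

def K0A (q : ℂ) (M N : ℕ) (ext : Bool) (lvl : ℕ) : ALG q M N ext lvl :=
  mkA q M N ext lvl (K0F M N ext)

def K0iA (q : ℂ) (M N : ℕ) (ext : Bool) (lvl : ℕ) : ALG q M N ext lvl :=
  mkA q M N ext lvl (K0iF M N ext)

def phiPA (q : ℂ) (M N : ℕ) (ext : Bool) (lvl : ℕ) (i : ℕ) (n : ℤ) : ALG q M N ext lvl :=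
  mkA q M N ext lvl (phiPF q M N ext i n)

def phiMA (q : ℂ) (M N : ℕ) (ext : Bool) (lvl : ℕ) (i : ℕ) (n : ℤ) : ALG q M N ext lvl :=
  mkA q M N ext lvl (phiMF q M N ext i n)

/-- `U⁺`: the subalgebra generated by the `X⁺_{i,n}`. -/
def Aplus (q : ℂ) (M N : ℕ) (ext : Bool) (lvl : ℕ) : Subalgebra ℂ (ALG q M N ext lvl) :=
  Algebra.adjoin ℂ {x | ∃ i : ℕ, ∃ n : ℤ, x = XpA q M N ext lvl i n}

/-- `U⁻`: the subalgebra generated by the `X⁻_{i,n}`. -/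
def Aminus (q : ℂ) (M N : ℕ) (ext : Bool) (lvl : ℕ) : Subalgebra ℂ (ALG q M N ext lvl) :=
  Algebra.adjoin ℂ {x | ∃ i : ℕ, ∃ n : ℤ, x = XmA q M N ext lvl i n}

/-- `U⁰`: the subalgebra generated by the `K_i^{±1}` and `h_{i,s}`. -/
def Azero (q : ℂ) (M N : ℕ) (ext : Bool) (lvl : ℕ) : Subalgebra ℂ (ALG q M N ext lvl) :=
  Algebra.adjoin ℂ {x | (∃ i : ℕ, x = KA q M N ext lvl i) ∨ (∃ i : ℕ, x = KiA q M N ext lvl i) ∨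
    ∃ i : ℕ, ∃ s : ℤ, x = HA q M N ext lvl i s}

/-- `U'⁰`: the subalgebra generated by `U⁰` and `K₀^{±1}`. -/
def AzeroE (q : ℂ) (M N : ℕ) (ext : Bool) (lvl : ℕ) : Subalgebra ℂ (ALG q M N ext lvl) :=
  Algebra.adjoin ℂ {x | (∃ i : ℕ, x = KA q M N ext lvl i) ∨ (∃ i : ℕ, x = KiA q M N ext lvl i) ∨
    (∃ i : ℕ, ∃ s : ℤ, x = HA q M N ext lvl i s) ∨ x = K0A q M N ext lvl ∨
      x = K0iA q M N ext lvl}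

/-! ### The multiplication map on the triple tensor product -/

def triMul (q : ℂ) (M N : ℕ) (ext : Bool) (lvl : ℕ)
    (S T R : Subalgebra ℂ (ALG q M N ext lvl)) :
    (↥S ⊗[ℂ] (↥T ⊗[ℂ] ↥R)) →ₗ[ℂ] ALG q M N ext lvl :=
  TensorProduct.lift
    (((LinearMap.mul ℂ (ALG q M N ext lvl)).comp S.val.toLinearMap).compl₂
      (TensorProduct.lift
        (((LinearMap.mul ℂ (ALG q M N ext lvl)).comp T.val.toLinearMap).compl₂
          R.val.toLinearMap)))

/-! ### Root vectors and PBW monomials -/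

def Xroot (q : ℂ) (M N : ℕ) (ext : Bool) (lvl : ℕ) (i : ℕ) : ℕ → ℤ → ALG q M N ext lvl
  | 0, n => XpA q M N ext lvl i n
  | k + 1, n =>
      brF (qpar q M (i + k + 1)) (Xroot q M N ext lvl i k n) (XpA q M N ext lvl (i + k + 1) 0)

/-- the root vector `X_{α_i + ⋯ + α_j}(n)`. -/
def XrootIJ (q : ℂ) (M N : ℕ) (ext : Bool) (lvl : ℕ) (i j : ℕ) (n : ℤ) : ALG q M N ext lvl :=
  Xroot q M N ext lvl i (j - i) n

def rootLE (a b : ℕ × ℕ) : Prop := a.1 < b.1 ∨ (a.1 = b.1 ∧ a.2 ≤ b.2)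

/-- the set of PBW ordered monomials in the root vectors. -/
def pbwSet (q : ℂ) (M N : ℕ) (ext : Bool) (lvl : ℕ) : Set (ALG q M N ext lvl) :=
  {x | ∃ L : List ((ℕ × ℕ) × ℤ),
      (∀ p ∈ L, 1 ≤ p.1.1 ∧ p.1.1 ≤ p.1.2 ∧ p.1.2 ≤ M + N - 1) ∧
      L.Chain' (fun a b => rootLE a.1 b.1) ∧
      x = (L.map fun p => XrootIJ q M N ext lvl p.1.1 p.1.2 p.2).prod}

/-- PBW ordered monomials of total degree `d` (`d i` counts the multiplicity of `α_i`). -/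
def pbwDegSet (q : ℂ) (M N : ℕ) (ext : Bool) (lvl : ℕ) (d : ℕ → ℕ) : Set (ALG q M N ext lvl) :=
  {x | ∃ L : List ((ℕ × ℕ) × ℤ),
      (∀ p ∈ L, 1 ≤ p.1.1 ∧ p.1.1 ≤ p.1.2 ∧ p.1.2 ≤ M + N - 1) ∧
      L.Chain' (fun a b => rootLE a.1 b.1) ∧
      (∀ i : ℕ, ((L.map fun p => if p.1.1 ≤ i ∧ i ≤ p.1.2 then 1 else 0).sum) = d i) ∧
      x = (L.map fun p => XrootIJ q M N ext lvl p.1.1 p.1.2 p.2).prod}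

/-- words in the generators `X⁺_{i,n}` of degree `d`. -/
def wordDegSet (q : ℂ) (M N : ℕ) (ext : Bool) (lvl : ℕ) (d : ℕ → ℕ) :
    Set (ALG q M N ext lvl) :=
  {x | ∃ w : List (ℕ × ℤ), (∀ p ∈ w, 1 ≤ p.1 ∧ p.1 ≤ M + N - 1) ∧
      (∀ i : ℕ, (w.map Prod.fst).count i = d i) ∧
      x = (w.map fun p => XpA q M N ext lvl p.1 p.2).prod}

/-! ### The subspaces `I^±_{i,j}` and `O^±` -/

def IElt (q : ℂ) (M N : ℕ) (ext : Bool) (lvl : ℕ) (pl : Bool) (i j : ℕ) (m n : ℤ) :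
    ALG q M N ext lvl :=
  let X : ℕ → ℤ → ALG q M N ext lvl := if pl then XpA q M N ext lvl else XmA q M N ext lvl
  let e : ℤ := if pl then cc M i j else -cc M i j
  if cc M i j = 0 then X i m * X j n - sgn M i j • (X j n * X i m)
  else
    X i (m + 1) * X j n - (q ^ e) • (X j n * X i (m + 1)) -
      (q ^ e) • (X i m * X j (n + 1)) + X j (n + 1) * X i m

def Isub (q : ℂ) (M N : ℕ) (ext : Bool) (lvl : ℕ) (pl : Bool) (i j : ℕ) :
    Submodule ℂ (ALG q M N ext lvl) :=
  Submodule.span ℂ (Set.range fun p : ℤ × ℤ => IElt q M N ext lvl pl i j p.1 p.2)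

def IsubAll (q : ℂ) (M N : ℕ) (ext : Bool) (lvl : ℕ) (pl : Bool) :
    Submodule ℂ (ALG q M N ext lvl) :=
  ⨆ p : ℕ × ℕ, ⨆ _ : 1 ≤ p.1 ∧ p.1 ≤ p.2 ∧ p.2 ≤ M + N - 1,
    Isub q M N ext lvl pl p.1 p.2

def OscElt (q : ℂ) (M N : ℕ) (ext : Bool) (lvl : ℕ) (pl : Bool) (m n k u : ℤ) :
    ALG q M N ext lvl :=
  let X : ℕ → ℤ → ALG q M N ext lvl := if pl then XpA q M N ext lvl else XmA q M N ext lvl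
  oscOf q M X m n k u + oscOf q M X m u k n

def Osub (q : ℂ) (M N : ℕ) (ext : Bool) (lvl : ℕ) (pl : Bool) :
    Submodule ℂ (ALG q M N ext lvl) :=
  Submodule.span ℂ
    (Set.range fun p : ℤ × ℤ × ℤ × ℤ => OscElt q M N ext lvl pl p.1 p.2.1 p.2.2.1 p.2.2.2)

/-- the sign `(−1)^{(p(α_k)+p(α_u))·p(α_i)}`. -/
def gsgn (M : ℕ) (k u i : ℕ) : ℂ :=
  if ((k = M ∧ ¬u = M) ∨ (¬k = M ∧ u = M)) ∧ i = M then -1 else 1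

/-! ### Highest weights and the associated eigenvalue sequences -/

/-- `Q·f = 0` for a bilateral formal series `f`. -/
def annih (Q : Polynomial ℂ) (f : ℤ → ℂ) : Prop :=
  ∀ n : ℤ, ∑ s ∈ Finset.range (Q.natDegree + 1), Q.coeff s * f (n - s) = 0

/-- an element of `R_{M,N}`: a highest weight `(P̲, f, c)`. -/
structure HW (q : ℂ) (M N : ℕ) : Type where
  P : ℕ → Polynomial ℂ
  f : ℤ → ℂ
  c : ℂ
  P_const : ∀ i, (P i).coeff 0 = 1
  c_ne : c ≠ 0
  torsion : ∃ Q : Polynomial ℂ, Q ≠ 0 ∧ annih Q f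
  f_zero : f 0 = (c - c⁻¹) / (q - q⁻¹)

def toPS (p : Polynomial ℂ) : PowerSeries ℂ := PowerSeries.mk fun n => p.coeff n

/-- `P(z·u)`. -/
def pscale (u : ℂ) (P : Polynomial ℂ) : Polynomial ℂ := P.comp (Polynomial.C u * Polynomial.X)

/-- the coefficient of `z^n` (`n ≥ 0`) in `q_i^{deg P} P(z q_i⁻¹)/P(z q_i)`,
expanded at `z = 0`. -/
def gammaP (q : ℂ) (M : ℕ) (i : ℕ) (P : Polynomial ℂ) (n : ℤ) : ℂ :=
  if 0 ≤ n then
    qpar q M i ^ P.natDegree *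
      PowerSeries.coeff (R := ℂ) n.toNat
        (toPS (pscale (qpar q M i)⁻¹ P) * (toPS (pscale (qpar q M i) P))⁻¹)
  else 0

/-- the coefficient of `z^n` (`n ≤ 0`) in `q_i^{deg P} P(z q_i⁻¹)/P(z q_i)`,
expanded at `z = ∞`. -/
def gammaM (q : ℂ) (M : ℕ) (i : ℕ) (P : Polynomial ℂ) (n : ℤ) : ℂ :=
  if n ≤ 0 then
    qpar q M i ^ P.natDegree *
      PowerSeries.coeff (R := ℂ) (-n).toNat
        (toPS ((pscale (qpar q M i)⁻¹ P).reflect P.natDegree) *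
          (toPS ((pscale (qpar q M i) P).reflect P.natDegree))⁻¹)
  else 0

/-! ### Verma, Weyl and simple modules -/

def vermaRels (q : ℂ) (M N : ℕ) (ext : Bool) (Λ : HW q M N) : Set (ALG q M N ext 3) :=
  {x | ∃ i : ℕ, ∃ n : ℤ, x = XpA q M N ext 3 i n} ∪
  {x | ∃ i : ℕ, ∃ n : ℤ, 1 ≤ i ∧ i ≤ M + N - 1 ∧ i ≠ M ∧
      (x = phiPA q M N ext 3 i n - algebraMap ℂ _ (gammaP q M i (Λ.P i) n) ∨
       x = phiMA q M N ext 3 i n - algebraMap ℂ _ (gammaM q M i (Λ.P i) n))} ∪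
  {x | x = KA q M N ext 3 M - algebraMap ℂ _ Λ.c} ∪
  {x | ∃ n : ℤ, x = phiPA q M N ext 3 M n - phiMA q M N ext 3 M n -
      algebraMap ℂ _ ((q - q⁻¹) * Λ.f n)} ∪
  {x | ext = true ∧ x = K0A q M N ext 3 - 1}

def evenRels (q : ℂ) (M N : ℕ) (ext : Bool) (Λ : HW q M N) : Set (ALG q M N ext 3) :=
  {x | ∃ i : ℕ, 1 ≤ i ∧ i ≤ M + N - 1 ∧ i ≠ M ∧
      x = XmA q M N ext 3 i 0 ^ (1 + (Λ.P i).natDegree)}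

def oddElt (q : ℂ) (M N : ℕ) (ext : Bool) (Q : Polynomial ℂ) (n : ℤ) : ALG q M N ext 3 :=
  ∑ s ∈ Finset.range (Q.natDegree + 1),
    Q.coeff (Q.natDegree - s) • XmA q M N ext 3 M ((s : ℤ) + n)

def oddRels (q : ℂ) (M N : ℕ) (ext : Bool) (Q : Polynomial ℂ) : Set (ALG q M N ext 3) :=
  if M = 1 ∧ N = 1 then {x | ∃ n : ℤ, x = oddElt q M N ext Q n}
  else {oddElt q M N ext Q 0}

def vermaIdeal (q : ℂ) (M N : ℕ) (ext : Bool) (Λ : HW q M N) : Ideal (ALG q M N ext 3) :=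
  Ideal.span (vermaRels q M N ext Λ)

def weylIdeal (q : ℂ) (M N : ℕ) (ext : Bool) (Λ : HW q M N) (Q : Polynomial ℂ) :
    Ideal (ALG q M N ext 3) :=
  Ideal.span (vermaRels q M N ext Λ ∪ evenRels q M N ext Λ ∪ oddRels q M N ext Q)

def uweylIdeal (q : ℂ) (M N : ℕ) (ext : Bool) (Λ : HW q M N) : Ideal (ALG q M N ext 3) :=
  Ideal.span (vermaRels q M N ext Λ ∪ evenRels q M N ext Λ)

/-- the Verma module `M(Λ)`. -/
def VermaMod (q : ℂ) (M N : ℕ) (ext : Bool) (Λ : HW q M N) : Type :=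
  ALG q M N ext 3 ⧸ vermaIdeal q M N ext Λ

/-- the Weyl module `W(Λ; Q)`. -/
def WeylMod (q : ℂ) (M N : ℕ) (ext : Bool) (Λ : HW q M N) (Q : Polynomial ℂ) : Type :=
  ALG q M N ext 3 ⧸ weylIdeal q M N ext Λ Q

/-- the universal Weyl module `W(Λ)`. -/
def UWeylMod (q : ℂ) (M N : ℕ) (ext : Bool) (Λ : HW q M N) : Type :=
  ALG q M N ext 3 ⧸ uweylIdeal q M N ext Λ

instance (q : ℂ) (M N : ℕ) (ext : Bool) (Λ : HW q M N) : AddCommGroup (VermaMod q M N ext Λ) :=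
  inferInstanceAs (AddCommGroup (ALG q M N ext 3 ⧸ vermaIdeal q M N ext Λ))
instance (q : ℂ) (M N : ℕ) (ext : Bool) (Λ : HW q M N) :
    Module (ALG q M N ext 3) (VermaMod q M N ext Λ) :=
  inferInstanceAs (Module (ALG q M N ext 3) (ALG q M N ext 3 ⧸ vermaIdeal q M N ext Λ))
instance (q : ℂ) (M N : ℕ) (ext : Bool) (Λ : HW q M N) : Module ℂ (VermaMod q M N ext Λ) :=
  inferInstanceAs (Module ℂ (ALG q M N ext 3 ⧸ vermaIdeal q M N ext Λ))
instance (q : ℂ) (M N : ℕ) (ext : Bool) (Λ : HW q M N) :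
    IsScalarTower ℂ (ALG q M N ext 3) (VermaMod q M N ext Λ) :=
  inferInstanceAs (IsScalarTower ℂ (ALG q M N ext 3) (ALG q M N ext 3 ⧸ vermaIdeal q M N ext Λ))

instance (q : ℂ) (M N : ℕ) (ext : Bool) (Λ : HW q M N) (Q : Polynomial ℂ) :
    AddCommGroup (WeylMod q M N ext Λ Q) :=
  inferInstanceAs (AddCommGroup (ALG q M N ext 3 ⧸ weylIdeal q M N ext Λ Q))
instance (q : ℂ) (M N : ℕ) (ext : Bool) (Λ : HW q M N) (Q : Polynomial ℂ) :
    Module (ALG q M N ext 3) (WeylMod q M N ext Λ Q) :=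
  inferInstanceAs (Module (ALG q M N ext 3) (ALG q M N ext 3 ⧸ weylIdeal q M N ext Λ Q))
instance (q : ℂ) (M N : ℕ) (ext : Bool) (Λ : HW q M N) (Q : Polynomial ℂ) :
    Module ℂ (WeylMod q M N ext Λ Q) :=
  inferInstanceAs (Module ℂ (ALG q M N ext 3 ⧸ weylIdeal q M N ext Λ Q))
instance (q : ℂ) (M N : ℕ) (ext : Bool) (Λ : HW q M N) (Q : Polynomial ℂ) :
    IsScalarTower ℂ (ALG q M N ext 3) (WeylMod q M N ext Λ Q) :=
  inferInstanceAs
    (IsScalarTower ℂ (ALG q M N ext 3) (ALG q M N ext 3 ⧸ weylIdeal q M N ext Λ Q))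

instance (q : ℂ) (M N : ℕ) (ext : Bool) (Λ : HW q M N) : AddCommGroup (UWeylMod q M N ext Λ) :=
  inferInstanceAs (AddCommGroup (ALG q M N ext 3 ⧸ uweylIdeal q M N ext Λ))
instance (q : ℂ) (M N : ℕ) (ext : Bool) (Λ : HW q M N) :
    Module (ALG q M N ext 3) (UWeylMod q M N ext Λ) :=
  inferInstanceAs (Module (ALG q M N ext 3) (ALG q M N ext 3 ⧸ uweylIdeal q M N ext Λ))
instance (q : ℂ) (M N : ℕ) (ext : Bool) (Λ : HW q M N) : Module ℂ (UWeylMod q M N ext Λ) :=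
  inferInstanceAs (Module ℂ (ALG q M N ext 3 ⧸ uweylIdeal q M N ext Λ))
instance (q : ℂ) (M N : ℕ) (ext : Bool) (Λ : HW q M N) :
    IsScalarTower ℂ (ALG q M N ext 3) (UWeylMod q M N ext Λ) :=
  inferInstanceAs (IsScalarTower ℂ (ALG q M N ext 3) (ALG q M N ext 3 ⧸ uweylIdeal q M N ext Λ))

/-- the highest weight vector (image of `1`). -/
def vgen (q : ℂ) (M N : ℕ) (Λ : HW q M N) : VermaMod q M N true Λ :=
  Submodule.Quotient.mk 1

/-- the sum of all submodules not containing the highest weight vector (the unique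
maximal submodule of the Verma module). -/
def radV (q : ℂ) (M N : ℕ) (Λ : HW q M N) :
    Submodule (ALG q M N true 3) (VermaMod q M N true Λ) :=
  sSup {p | vgen q M N Λ ∉ p}

/-- the simple quotient `S'(Λ)`. -/
def SimpMod (q : ℂ) (M N : ℕ) (Λ : HW q M N) : Type :=
  VermaMod q M N true Λ ⧸ radV q M N Λ

instance (q : ℂ) (M N : ℕ) (Λ : HW q M N) : AddCommGroup (SimpMod q M N Λ) :=
  inferInstanceAs (AddCommGroup (VermaMod q M N true Λ ⧸ radV q M N Λ))
instance (q : ℂ) (M N : ℕ) (Λ : HW q M N) :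
    Module (ALG q M N true 3) (SimpMod q M N Λ) :=
  inferInstanceAs (Module (ALG q M N true 3) (VermaMod q M N true Λ ⧸ radV q M N Λ))
instance (q : ℂ) (M N : ℕ) (Λ : HW q M N) : Module ℂ (SimpMod q M N Λ) :=
  inferInstanceAs (Module ℂ (VermaMod q M N true Λ ⧸ radV q M N Λ))
instance (q : ℂ) (M N : ℕ) (Λ : HW q M N) :
    IsScalarTower ℂ (ALG q M N true 3) (SimpMod q M N Λ) :=
  inferInstanceAs (IsScalarTower ℂ (ALG q M N true 3) (VermaMod q M N true Λ ⧸ radV q M N Λ))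

/-! ### Weight spaces -/

/-- `K_i` for `0 ≤ i`, with `K₀` at `i = 0`. -/
def Kgen (q : ℂ) (M N : ℕ) (ext : Bool) (lvl : ℕ) (i : ℕ) : ALG q M N ext lvl :=
  if i = 0 then K0A q M N ext lvl else KA q M N ext lvl i

/-- the `μ`-weight space of a module. -/
def wtSp (q : ℂ) (M N : ℕ) (ext : Bool) {W : Type} [AddCommGroup W] [Module ℂ W]
    [Module (ALG q M N ext 3) W] [IsScalarTower ℂ (ALG q M N ext 3) W] (μ : ℕ → ℂ) :
    Submodule ℂ W where
  carrier := {w | ∀ i < M + N, Kgen q M N ext 3 i • w = μ i • w}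
  add_mem' := by
    intro a b ha hb i hi
    rw [smul_add, ha i hi, hb i hi, smul_add]
  zero_mem' := by
    intro i hi
    rw [smul_zero, smul_zero]
  smul_mem' := by
    intro c w hw i hi
    have h1 : Kgen q M N ext 3 i • (c • w) = c • (Kgen q M N ext 3 i • w) := by
      rw [← algebraMap_smul (ALG q M N ext 3) c w, ← mul_smul, ← Algebra.commutes, mul_smul,
        algebraMap_smul]
    rw [h1, hw i hi, smul_comm]

/-- the character `λ_Λ`. -/
def lamF (q : ℂ) (M N : ℕ) (Λ : HW q M N) : ℕ → ℂ :=
  fun i => if i = 0 then 1 else if i = M then Λ.c else qpar q M i ^ (Λ.P i).natDegree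

/-- the character `α_j`. -/
def alF (q : ℂ) (M : ℕ) (j : ℕ) : ℕ → ℂ :=
  fun i => if i = 0 then (if j = 1 then q else 1) else q ^ cc M j i

/-! ### The generators of `U` inside `U'` -/

def UGenSet (q : ℂ) (M N : ℕ) : Set (ALG q M N true 3) :=
  {x | (∃ i : ℕ, ∃ n : ℤ, x = XpA q M N true 3 i n) ∨
    (∃ i : ℕ, ∃ n : ℤ, x = XmA q M N true 3 i n) ∨
    (∃ i : ℕ, x = KA q M N true 3 i) ∨ (∃ i : ℕ, x = KiA q M N true 3 i) ∨
    ∃ i : ℕ, ∃ s : ℤ, x = HA q M N true 3 i s}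

/-! ### One-sided presentations (for `U^±`) -/

def XgF (M N : ℕ) (i : ℕ) (n : ℤ) : FreeAlgebra ℂ (Idx M N × ℤ) :=
  if h : 1 ≤ i ∧ i ≤ M + N - 1 then FreeAlgebra.ι ℂ ((⟨i, h⟩, n) : Idx M N × ℤ) else 0

inductive rel1 (q : ℂ) (M N : ℕ) (pl : Bool) :
    FreeAlgebra ℂ (Idx M N × ℤ) → FreeAlgebra ℂ (Idx M N × ℤ) → Prop
  | comm0 (i j : Idx M N) (m n : ℤ) (h : cc M i.1 j.1 = 0) :
      rel1 q M N pl
        (FreeAlgebra.ι ℂ ((i, m) : Idx M N × ℤ) * FreeAlgebra.ι ℂ ((j, n) : Idx M N × ℤ) -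
          sgn M i.1 j.1 •
            (FreeAlgebra.ι ℂ ((j, n) : Idx M N × ℤ) * FreeAlgebra.ι ℂ ((i, m) : Idx M N × ℤ))) 0
  | deg2 (i j : Idx M N) (m n : ℤ) (h : cc M i.1 j.1 ≠ 0) :
      rel1 q M N pl
        (FreeAlgebra.ι ℂ ((i, m + 1) : Idx M N × ℤ) * FreeAlgebra.ι ℂ ((j, n) : Idx M N × ℤ) -
          (q ^ (if pl then cc M i.1 j.1 else -cc M i.1 j.1)) •
            (FreeAlgebra.ι ℂ ((j, n) : Idx M N × ℤ) *
              FreeAlgebra.ι ℂ ((i, m + 1) : Idx M N × ℤ)))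
        ((q ^ (if pl then cc M i.1 j.1 else -cc M i.1 j.1)) •
            (FreeAlgebra.ι ℂ ((i, m) : Idx M N × ℤ) *
              FreeAlgebra.ι ℂ ((j, n + 1) : Idx M N × ℤ)) -
          FreeAlgebra.ι ℂ ((j, n + 1) : Idx M N × ℤ) * FreeAlgebra.ι ℂ ((i, m) : Idx M N × ℤ))
  | serre (i j : Idx M N) (m n k : ℤ) (h : cc M i.1 j.1 = 1 ∨ cc M i.1 j.1 = -1)
      (hi : i.1 ≠ M) :
      rel1 q M N pl
        (brF q (FreeAlgebra.ι ℂ ((i, m) : Idx M N × ℤ))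
            (brF q⁻¹ (FreeAlgebra.ι ℂ ((i, n) : Idx M N × ℤ))
              (FreeAlgebra.ι ℂ ((j, k) : Idx M N × ℤ))) +
          brF q (FreeAlgebra.ι ℂ ((i, n) : Idx M N × ℤ))
            (brF q⁻¹ (FreeAlgebra.ι ℂ ((i, m) : Idx M N × ℤ))
              (FreeAlgebra.ι ℂ ((j, k) : Idx M N × ℤ)))) 0
  | osc (m n k u : ℤ) (hM : 1 < M) (hN : 1 < N) :
      rel1 q M N pl (oscOf q M (XgF M N) m n k u + oscOf q M (XgF M N) m u k n) 0

end QAS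

namespace QASProof

variable {A : Type} [Ring A] [Algebra ℂ A]

structure DSys (D : ℕ → Submodule ℂ A) (x : ℕ → A) : Prop where
  hx : ∀ k, x k ∈ D k
  h1 : ∀ i j, i + 2 ≤ j → D j * D i = D i * D j
  h2a : ∀ j, D (j+1) * (D (j+1) * D j) ≤
    D (j+1) * (D j * D (j+1)) ⊔ D j * (D (j+1) * D (j+1))
  h2b : ∀ j, D (j+1) * (D j * D j) ≤
    D j * (D (j+1) * D j) ⊔ D j * (D j * D (j+1))
  h4a : ∀ j, D (j+1) * (D (j+2) * (D (j+1) * D j)) ≤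
    (D j * (D (j+1) * (D (j+2) * D (j+1))) ⊔ D j * (D (j+2) * (D (j+1) * D (j+1))) ⊔
      D (j+1) * (D j * (D (j+2) * D (j+1))) ⊔ D (j+1) * (D j * (D (j+1) * D (j+2))) ⊔
      D (j+1) * (D (j+1) * (D j * D (j+2))) ⊔ D (j+2) * (D (j+1) * (D (j+1) * D j))) ⊔
      D (j+2) * (D (j+1) * (D j * D (j+1)))
  h4b : ∀ j, D (j+2) * (D (j+1) * (D j * D (j+1))) ≤
    (D j * (D (j+1) * (D (j+2) * D (j+1))) ⊔ D j * (D (j+2) * (D (j+1) * D (j+1))) ⊔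
      D (j+1) * (D j * (D (j+2) * D (j+1))) ⊔ D (j+1) * (D j * (D (j+1) * D (j+2))) ⊔
      D (j+1) * (D (j+1) * (D j * D (j+2))) ⊔ D (j+2) * (D (j+1) * (D (j+1) * D j))) ⊔
      D (j+1) * (D (j+2) * (D (j+1) * D j))
  h5 : ∀ j, D (j+1) * D j ≤ Submodule.span ℂ {x (j+1)} * D j ⊔ D j * D (j+1)

/-- the subalgebra generated by the `D j`, `j ≥ i`. -/
def BB (D : ℕ → Submodule ℂ A) (i : ℕ) : Submodule ℂ A :=
  Subalgebra.toSubmodule (Algebra.adjoin ℂ {y | ∃ j, i ≤ j ∧ y ∈ D j})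

/-- `D (i+k-1) ⋯ D i`. -/
def CC (D : ℕ → Submodule ℂ A) (i : ℕ) : ℕ → Submodule ℂ A
  | 0 => 1
  | k + 1 => D (i + k) * CC D i k

def FF (D : ℕ → Submodule ℂ A) (i : ℕ) : ℕ → Submodule ℂ A
  | 0 => ⊥
  | k + 1 => FF D i k ⊔ CC D i (k + 1) * BB D (i + 1)

def GG (D : ℕ → Submodule ℂ A) (i : ℕ) : Submodule ℂ A := ⨆ k, FF D i k

variable {D : ℕ → Submodule ℂ A} {x : ℕ → A}

lemma one_le_BB (i : ℕ) : 1 ≤ BB D i := by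
  rw [Submodule.one_le]; exact one_mem (Algebra.adjoin ℂ _)

lemma BB_mul (i : ℕ) : BB D i * BB D i ≤ BB D i := by
  rw [Submodule.mul_le]; intro a ha b hb
  exact mul_mem (S := Subalgebra ℂ A) ha hb

lemma D_le_BB {i j : ℕ} (h : i ≤ j) : D j ≤ BB D i := fun _ hy =>
  Algebra.subset_adjoin ⟨j, h, hy⟩

lemma BB_stable {i : ℕ} {S : Submodule ℂ A} (h : ∀ j, i ≤ j → D j * S ≤ S) :
    BB D i * S ≤ S := by
  rw [Submodule.mul_le]
  intro b hb
  change b ∈ Algebra.adjoin ℂ _ at hb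
  induction hb using Algebra.adjoin_induction with
  | mem y hy =>
    obtain ⟨j, hj, hy⟩ := hy
    intro s hs
    exact h j hj (Submodule.mul_mem_mul hy hs)
  | algebraMap r => intro s hs; rw [← Algebra.smul_def]; exact S.smul_mem _ hs
  | add a b _ _ ha hb => intro s hs; rw [add_mul]; exact S.add_mem (ha s hs) (hb s hs)
  | mul a b _ _ ha hb => intro s hs; rw [mul_assoc]; exact ha _ (hb s hs)

lemma mulB {i : ℕ} {X Y : Submodule ℂ A} (hX : X ≤ BB D i) (hY : Y ≤ BB D i) :
    X * Y ≤ BB D i := (mul_le_mul' hX hY).trans (BB_mul i)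

lemma FF_mono (i : ℕ) : Monotone (FF D i) := monotone_nat_of_le_succ fun k => by
  simp only [FF]; exact le_sup_left

lemma FF_mul_BB (i k : ℕ) : FF D i k * BB D (i+1) ≤ FF D i k := by
  induction k with
  | zero => simp [FF]
  | succ k ih =>
    simp only [FF, Submodule.sup_mul]
    refine sup_le_sup ih ?_
    rw [mul_assoc]; exact mul_le_mul' le_rfl (BB_mul _)

lemma FF_mul {i k : ℕ} {X Y : Submodule ℂ A} (hX : X ≤ FF D i k) (hY : Y ≤ BB D (i+1)) :
    X * Y ≤ FF D i k := (mul_le_mul' hX hY).trans (FF_mul_BB i k)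

lemma CC_le_FF {i k : ℕ} : CC D i (k+1) ≤ FF D i (k+1) := by
  simp only [FF]
  refine le_sup_of_le_right ?_
  calc _ = CC D i (k+1) * 1 := (mul_one _).symm
    _ ≤ _ := mul_le_mul' le_rfl (one_le_BB _)

lemma CC_mul {i k K : ℕ} (hk : k + 1 ≤ K) {Y : Submodule ℂ A} (hY : Y ≤ BB D (i+1)) :
    CC D i (k+1) * Y ≤ FF D i K :=
  FF_mul (CC_le_FF.trans (FF_mono i hk)) hY

lemma FF_le_GG {i k : ℕ} : FF D i k ≤ GG D i := le_iSup (FF D i) k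

lemma GG_mul_BB (i : ℕ) : GG D i * BB D (i+1) ≤ GG D i := by
  rw [GG, Submodule.iSup_mul]
  exact iSup_mono fun k => FF_mul_BB i k

variable (h : DSys D x)
include h

lemma D_CC {i k j : ℕ} (hj : i + k + 1 ≤ j) : D j * CC D i k = CC D i k * D j := by
  induction k with
  | zero => simp [CC]
  | succ k ih =>
    rw [CC, ← mul_assoc, h.h1 (i+k) j (by omega), mul_assoc, ih (by omega), mul_assoc]

lemma D_FF_gt {i k j : ℕ} (hj : i + k + 1 ≤ j) : D j * FF D i k ≤ FF D i k := by
  induction k with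
  | zero => simp [FF]
  | succ k ih =>
    rw [FF, Submodule.mul_sup]
    refine sup_le ((ih (by omega)).trans le_sup_left) ?_
    rw [← mul_assoc, D_CC h (by omega), mul_assoc]
    exact le_sup_of_le_right (mul_le_mul' le_rfl (mulB (D_le_BB (by omega)) le_rfl))

lemma D_FF_eq {i k : ℕ} : D (i + k) * FF D i k ≤ FF D i (k+1) := by
  cases k with
  | zero => simp [FF]
  | succ k =>
    conv_lhs => rw [FF, Submodule.mul_sup]
    refine sup_le ((D_FF_gt h (by omega)).trans (FF_mono i (by omega))) ?_
    rw [← mul_assoc]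
    exact CC_mul (k := k+1) le_rfl le_rfl

lemma D_CC_eq {i l : ℕ} : D (i + l + 1) * CC D i (l + 2) ≤ FF D i (l + 2) := by
  have hc : D (i+l+1) * CC D i l = CC D i l * D (i+l+1) := D_CC h (by omega)
  have hB : D (i+l+1) ≤ BB D (i+1) := D_le_BB (by omega)
  have := mul_le_mul' (h.h2a (i+l)) (le_refl (CC D i l))
  calc D (i + l + 1) * CC D i (l + 2)
      = D (i+l+1) * (D (i+l+1) * D (i+l)) * CC D i l := by simp only [CC, mul_assoc, add_assoc]
    _ ≤ _ := this
    _ = CC D i (l+2) * D (i+l+1) ⊔ CC D i (l+1) * (D (i+l+1) * D (i+l+1)) := by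
        rw [Submodule.sup_mul]
        have e1 : CC D i (l+1) = D (i+l) * CC D i l := rfl
        have e2 : CC D i (l+2) = D (i+l+1) * (D (i+l) * CC D i l) := rfl
        simp only [e1, e2, mul_assoc, hc]
        rw [← mul_assoc (D (i+l+1)) (CC D i l), hc, mul_assoc]
    _ ≤ _ := sup_le (CC_mul (by omega) hB) (CC_mul (by omega) (mulB hB hB))

lemma R_le {i l : ℕ} :
    (D (i+l) * (D (i+l+1) * (D (i+l+2) * D (i+l+1))) ⊔
      D (i+l) * (D (i+l+2) * (D (i+l+1) * D (i+l+1))) ⊔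
      D (i+l+1) * (D (i+l) * (D (i+l+2) * D (i+l+1))) ⊔
      D (i+l+1) * (D (i+l) * (D (i+l+1) * D (i+l+2))) ⊔
      D (i+l+1) * (D (i+l+1) * (D (i+l) * D (i+l+2)))) * CC D i l ≤ FF D i (l+2) := by
  have hb : D (i+l+1) * CC D i l = CC D i l * D (i+l+1) := D_CC h (by omega)
  have hc : D (i+l+2) * CC D i l = CC D i l * D (i+l+2) := D_CC h (by omega)
  have hb' : ∀ z, D (i+l+1) * (CC D i l * z) = CC D i l * (D (i+l+1) * z) := fun z => by
    rw [← mul_assoc, hb, mul_assoc]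
  have hc' : ∀ z, D (i+l+2) * (CC D i l * z) = CC D i l * (D (i+l+2) * z) := fun z => by
    rw [← mul_assoc, hc, mul_assoc]
  have hB : D (i+l+1) ≤ BB D (i+1) := D_le_BB (by omega)
  have hC : D (i+l+2) ≤ BB D (i+1) := D_le_BB (by omega)
  have e1 : ∀ z, D (i+l) * (CC D i l * z) = CC D i (l+1) * z := fun z => by
    simp only [CC, mul_assoc]
  have e2 : ∀ z, D (i+l+1) * (CC D i (l+1) * z) = CC D i (l+2) * z := fun z => by
    simp only [CC, mul_assoc, add_assoc]
  simp only [Submodule.sup_mul, mul_assoc, hb, hc, hb', hc', e1, e2]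
  refine sup_le (sup_le (sup_le (sup_le ?_ ?_) ?_) ?_) ?_
  · exact CC_mul (by omega) (mulB hB (mulB hC hB))
  · exact CC_mul (by omega) (mulB hC (mulB hB hB))
  · exact CC_mul (by omega) (mulB hC hB)
  · exact CC_mul (by omega) (mulB hB hC)
  · rw [← mul_assoc]
    exact FF_mul (D_CC_eq h) hC

lemma D_CC_lt {i l k : ℕ} (hk : l + 2 ≤ k) : D (i + l + 1) * CC D i k ≤ FF D i k := by
  induction k, hk using Nat.le_induction with
  | base => exact D_CC_eq h
  | succ k hk ih =>
    rcases Nat.eq_or_lt_of_le hk with rfl | hk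
    · -- k + 1 = l + 3
      have hb : D (i+l+1) * CC D i l = CC D i l * D (i+l+1) := D_CC h (by omega)
      have hB : D (i+l+1) ≤ BB D (i+1) := D_le_BB (by omega)
      calc D (i + l + 1) * CC D i (l + 2 + 1)
        = D (i+l+1) * (D (i+l+2) * (D (i+l+1) * D (i+l))) * CC D i l := by
            simp only [CC, mul_assoc, add_assoc, Nat.reduceAdd]
        _ ≤ _ := mul_le_mul' (h.h4a (i+l)) (le_refl (CC D i l))
        _ ≤ _ := by
          rw [Submodule.sup_mul, Submodule.sup_mul]
          refine sup_le (sup_le ?_ ?_) ?_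
          · exact (R_le h).trans (FF_mono i (by omega))
          · calc _ = D (i+(l+2)) * (D (i+l+1) * CC D i (l+2)) := by
                  simp only [CC, mul_assoc, add_assoc]
              _ ≤ _ := (mul_le_mul' le_rfl (D_CC_eq h)).trans (D_FF_eq h)
          · calc _ = CC D i (l+3) * D (i+l+1) := by
                  simp only [CC, mul_assoc, add_assoc, Nat.reduceAdd] at hb ⊢
                  simp only [hb]
              _ ≤ _ := CC_mul (by omega) hB
    · rw [CC, ← mul_assoc, ← h.h1 (i+l+1) (i+k) (by omega), mul_assoc]
      exact (mul_le_mul' le_rfl ih).trans (D_FF_eq h)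

lemma D_FF_lt {i l k : ℕ} (hk : l + 2 ≤ k) : D (i + l + 1) * FF D i k ≤ FF D i k := by
  induction k, hk using Nat.le_induction with
  | base =>
    have e : D (i + l + 1) * FF D i (l + 1) ≤ FF D i (l + 2) := D_FF_eq h (k := l + 1)
    conv_lhs => rw [FF, Submodule.mul_sup]
    refine sup_le e ?_
    rw [← mul_assoc]
    exact FF_mul (D_CC_eq h) le_rfl
  | succ k hk ih =>
    conv_lhs => rw [FF, Submodule.mul_sup]
    refine sup_le (ih.trans (FF_mono i (by omega))) ?_
    rw [← mul_assoc]
    exact FF_mul (D_CC_lt h (by omega)) le_rfl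

lemma D_FF {i j k : ℕ} (hj : i + 1 ≤ j) : D j * FF D i k ≤ FF D i (k+1) := by
  obtain ⟨l, rfl⟩ := Nat.exists_eq_add_of_le hj
  rw [show i + 1 + l = i + l + 1 by omega]
  rcases lt_trichotomy (l+1) k with hl | hl | hl
  · exact (D_FF_lt h (by omega)).trans (FF_mono i (by omega))
  · subst hl; exact D_FF_eq h (k := l + 1)
  · exact (D_FF_gt h (by omega)).trans (FF_mono i (by omega))

lemma D_GG {i j : ℕ} (hj : i + 1 ≤ j) : D j * GG D i ≤ GG D i := by
  conv_lhs => rw [GG, Submodule.mul_iSup]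
  exact iSup_le fun k => (D_FF h hj).trans FF_le_GG

lemma BB_GG {i : ℕ} : BB D (i+1) * GG D i ≤ GG D i := BB_stable fun _ hj => D_GG h hj

lemma CC_D {i l k : ℕ} (hk : l + 3 ≤ k) :
    CC D i k * D (i+l+1) ≤ D (i+l+1) * CC D i k ⊔ FF D i (l+2) := by
  induction k, hk using Nat.le_induction with
  | base =>
    have hb : D (i+l+1) * CC D i l = CC D i l * D (i+l+1) := D_CC h (by omega)
    have hC : D (i+l+2) ≤ BB D (i+1) := D_le_BB (by omega)
    have hc : D (i+l+2) * D (i+l) = D (i+l) * D (i+l+2) := h.h1 _ _ (by omega)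
    have hcC : D (i+l+2) * CC D i l = CC D i l * D (i+l+2) := D_CC h (by omega)
    have e3 : D (i+l+1) * CC D i (l+3) = D (i+l+1) * (D (i+l+2) * (D (i+l+1) * D (i+l))) * CC D i l := by
      simp only [CC, mul_assoc, add_assoc, Nat.reduceAdd]
    calc CC D i (l + 3) * D (i+l+1)
        = D (i+l+2) * (D (i+l+1) * (D (i+l) * D (i+l+1))) * CC D i l := by
            simp only [CC, mul_assoc, add_assoc, Nat.reduceAdd] at hb ⊢
            simp only [hb]
      _ ≤ _ := mul_le_mul' (h.h4b (i+l)) (le_refl (CC D i l))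
      _ ≤ _ := by
          rw [Submodule.sup_mul, Submodule.sup_mul]
          refine sup_le (sup_le ?_ ?_) ?_
          · exact (R_le h).trans le_sup_right
          · calc _ = D (i+l+2) * (D (i+l+1) * D (i+l+1)) * (D (i+l) * CC D i l) := by
                  simp only [mul_assoc]
              _ ≤ _ := mul_le_mul' (h.h2b (i+l+1)) le_rfl
              _ = D (i+l+1) * CC D i (l+3) ⊔ D (i+l+1) * CC D i (l+2) * D (i+l+2) := by
                  rw [e3, Submodule.sup_mul]
                  congr 1
                  · simp only [mul_assoc, add_assoc, Nat.reduceAdd]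
                  · have : CC D i (l+2) = D (i+l+1) * (D (i+l) * CC D i l) := rfl
                    rw [this]
                    simp only [mul_assoc, add_assoc, Nat.reduceAdd] at hc hcC ⊢
                    rw [← hcC, ← mul_assoc (D (i + (l+2))), hc, mul_assoc]
              _ ≤ _ := sup_le_sup le_rfl (FF_mul (D_CC_eq h) hC)
          · rw [e3]; exact le_sup_left
  | succ k hk ih =>
    calc CC D i (k+1) * D (i+l+1) = D (i+k) * (CC D i k * D (i+l+1)) := by rw [CC, mul_assoc]
      _ ≤ _ := mul_le_mul' le_rfl ih
      _ = D (i+l+1) * CC D i (k+1) ⊔ D (i+k) * FF D i (l+2) := by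
          rw [Submodule.mul_sup, ← mul_assoc, h.h1 (i+l+1) (i+k) (by omega), mul_assoc, CC]
      _ ≤ _ := sup_le_sup le_rfl (D_FF_gt h (by omega))

lemma CC_CC_zero {i k : ℕ} (hk : 2 ≤ k) : CC D i k * D i ≤ FF D i 1 * GG D i := by
  have hD : D i ≤ FF D i 1 := by
    have := CC_le_FF (D := D) (i := i) (k := 0)
    simpa [CC] using this
  have hD1 : D i ≤ GG D i := hD.trans FF_le_GG
  induction k, hk using Nat.le_induction with
  | base =>
    calc CC D i 2 * D i = D (i+1) * (D i * D i) := by simp [CC, mul_assoc]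
      _ ≤ _ := h.h2b i
      _ ≤ _ := sup_le (mul_le_mul' hD ?_) (mul_le_mul' hD ?_)
    · exact (mul_le_mul' le_rfl hD1).trans (D_GG h le_rfl)
    · exact (mul_le_mul' hD1 (D_le_BB le_rfl)).trans (GG_mul_BB i)
  | succ k hk ih =>
    rw [CC, mul_assoc]
    refine (mul_le_mul' le_rfl ih).trans ?_
    rw [← mul_assoc]
    exact mul_le_mul' (D_FF_gt h (by omega)) le_rfl

lemma CC_CC {i k l : ℕ} (hl : l < k) : CC D i (k+1) * CC D i (l+1) ≤ FF D i k * GG D i := by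
  induction l with
  | zero =>
    have := CC_CC_zero h (i := i) (k := k+1) (by omega)
    simp only [CC, add_zero, mul_one, zero_add] at this ⊢
    exact this.trans (mul_le_mul' (FF_mono i (by omega)) le_rfl)
  | succ l ih =>
    calc CC D i (k+1) * CC D i (l+1+1) = CC D i (k+1) * D (i+l+1) * CC D i (l+1) := by
          rw [mul_assoc]; rfl
      _ ≤ _ := mul_le_mul' (CC_D h (by omega)) le_rfl
      _ ≤ _ := by
          rw [Submodule.sup_mul, mul_assoc]
          refine sup_le ?_ ?_
          · refine (mul_le_mul' le_rfl (ih (by omega))).trans ?_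
            rw [← mul_assoc]
            exact mul_le_mul' (D_FF_lt h (by omega)) le_rfl
          · exact mul_le_mul' (FF_mono i (by omega)) (CC_le_FF.trans FF_le_GG)

/-! #### the root vector spaces -/

structure VSys (D : ℕ → Submodule ℂ A) (x : ℕ → A) (i : ℕ) (V : ℕ → Submodule ℂ A) : Prop where
  v0 : V 0 = D i
  v1 : ∀ k, V (k+1) ≤ V k * Submodule.span ℂ {x (i+k+1)} ⊔ Submodule.span ℂ {x (i+k+1)} * V k
  v2 : ∀ k, Submodule.span ℂ {x (i+k+1)} * V k ≤ V (k+1) ⊔ V k * Submodule.span ℂ {x (i+k+1)}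

variable {i : ℕ} {V : ℕ → Submodule ℂ A} (hV : VSys D x i V)
include hV

lemma V_le (k : ℕ) : V k ≤ CC D i (k+1) ⊔ FF D i k := by
  induction k with
  | zero => rw [hV.v0]; simp [CC]
  | succ k ih =>
    have hx : Submodule.span ℂ {x (i+k+1)} ≤ D (i+k+1) := by
      rw [Submodule.span_singleton_le_iff_mem]; exact h.hx _
    refine (hV.v1 k).trans (sup_le ?_ ?_)
    · refine (mul_le_mul' ih hx).trans (le_sup_of_le_right ?_)
      refine FF_mul (sup_le CC_le_FF (FF_mono i (by omega))) (D_le_BB (by omega))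
    · refine (mul_le_mul' hx ih).trans ?_
      rw [Submodule.mul_sup]
      exact sup_le_sup le_rfl ((D_FF_gt h (by omega)).trans (FF_mono i (by omega)))

lemma V_le_FF (k : ℕ) : V k ≤ FF D i (k+1) :=
  (V_le h hV k).trans (sup_le CC_le_FF (FF_mono i (by omega)))

lemma CC_le_V (k : ℕ) : CC D i (k+1) ≤ V k ⊔ FF D i k := by
  induction k with
  | zero => rw [hV.v0]; simp [CC]
  | succ k ih =>
    have hx : Submodule.span ℂ {x (i+k+1)} ≤ D (i+k+1) := by
      rw [Submodule.span_singleton_le_iff_mem]; exact h.hx _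
    have hD : D (i+k+1) ≤ BB D (i+1) := D_le_BB (by omega)
    calc CC D i (k+1+1) = D (i+k+1) * D (i+k) * CC D i k := by
          rw [mul_assoc]; rfl
      _ ≤ _ := mul_le_mul' (h.h5 _) le_rfl
      _ = Submodule.span ℂ {x (i+k+1)} * CC D i (k+1) ⊔ CC D i (k+1) * D (i+k+1) := by
          rw [Submodule.sup_mul, mul_assoc, mul_assoc,
            D_CC h (i := i) (k := k) (j := i+k+1) le_rfl, CC, mul_assoc]
      _ ≤ _ := by
          refine sup_le ((mul_le_mul' le_rfl ih).trans ?_) ?_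
          · rw [Submodule.mul_sup]
            refine sup_le ((hV.v2 k).trans (sup_le_sup le_rfl ?_)) ?_
            · exact FF_mul (V_le_FF h hV k) (hx.trans hD)
            · exact le_sup_of_le_right ((mul_le_mul' hx le_rfl).trans
                ((D_FF_gt h (by omega)).trans (FF_mono i (by omega))))
          · exact le_sup_of_le_right (CC_mul le_rfl hD)

lemma FF_V {k : ℕ} {P R : Submodule ℂ A} (hP : ∀ a < k, V a * (BB D (i+1) * P) ≤ R) :
    FF D i k * P ≤ R := by
  induction k with
  | zero => simp [FF]
  | succ k ih =>
    have ih' := ih fun a ha => hP a (by omega)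
    rw [FF, Submodule.sup_mul]
    refine sup_le ih' ?_
    refine (mul_le_mul' (mul_le_mul' (CC_le_V h hV k) le_rfl) le_rfl).trans ?_
    rw [Submodule.sup_mul, Submodule.sup_mul]
    refine sup_le ?_ ((mul_le_mul' (FF_mul_BB i k) le_rfl).trans ih')
    rw [mul_assoc]; exact hP k (by omega)

lemma V_V {k l : ℕ} (hl : l < k) : V k * V l ≤ FF D i k * GG D i := by
  have key : ∀ l, l ≤ k → CC D i (k+1) * FF D i l ≤ FF D i k * GG D i := by
    intro l hl
    induction l with
    | zero => simp [FF]
    | succ l ih =>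
      rw [FF, Submodule.mul_sup]
      refine sup_le (ih (by omega)) ?_
      rw [← mul_assoc]
      refine (mul_le_mul' (CC_CC h (by omega)) le_rfl).trans ?_
      rw [mul_assoc]
      exact mul_le_mul' le_rfl (GG_mul_BB i)
  refine (mul_le_mul' (V_le h hV k) (V_le_FF h hV l)).trans ?_
  rw [Submodule.sup_mul]
  exact sup_le (key _ hl) (mul_le_mul' le_rfl FF_le_GG)

omit h hV in
def PP (D : ℕ → Submodule ℂ A) (i : ℕ) (V : ℕ → Submodule ℂ A) : ℕ → ℕ → Submodule ℂ A
  | 0, _ => BB D (i+1)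
  | d + 1, k => ⨆ a, ⨆ (_ : k ≤ a), V a * PP D i V d a

omit h hV in
lemma PP_anti (d : ℕ) {k l : ℕ} (hkl : k ≤ l) : PP D i V d l ≤ PP D i V d k := by
  cases d with
  | zero => exact le_rfl
  | succ d =>
    simp only [PP]
    exact iSup_le fun a => iSup_le fun ha => le_iSup₂_of_le a (hkl.trans ha) le_rfl

lemma PP_main (d : ℕ) : BB D (i+1) * PP D i V d 0 ≤ PP D i V d 0 ∧
    ∀ k, V k * PP D i V d 0 ≤ PP D i V (d+1) 0 := by
  induction d with
  | zero =>
    refine ⟨BB_mul _, fun k => ?_⟩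
    simp only [PP]
    exact le_iSup₂_of_le k (Nat.zero_le _) le_rfl
  | succ d ih =>
    obtain ⟨ih1, ih2⟩ := ih
    have hF : ∀ k, FF D i k * PP D i V d 0 ≤ PP D i V (d+1) 0 := fun k =>
      FF_V h hV fun a _ => (mul_le_mul' le_rfl ih1).trans (ih2 a)
    have hG : GG D i * PP D i V d 0 ≤ PP D i V (d+1) 0 := by
      rw [GG, Submodule.iSup_mul]; exact iSup_le hF
    have hB : BB D (i+1) * PP D i V (d+1) 0 ≤ PP D i V (d+1) 0 := by
      refine BB_stable fun j hj => ?_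
      conv_lhs => rw [PP]
      simp only [Submodule.mul_iSup]
      refine iSup_le fun a => iSup_le fun _ => ?_
      rw [← mul_assoc]
      refine le_trans (mul_le_mul' ?_ (PP_anti d (Nat.zero_le a))) hG
      exact (mul_le_mul' le_rfl ((V_le_FF h hV a).trans FF_le_GG)).trans (D_GG h hj)
    refine ⟨hB, fun k => ?_⟩
    induction k using Nat.strong_induction_on with
    | _ k ihk =>
    conv_lhs => rw [PP]
    simp only [Submodule.mul_iSup]
    refine iSup_le fun l => iSup_le fun _ => ?_
    rcases lt_or_ge l k with hl | hl
    · rw [← mul_assoc]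
      refine (mul_le_mul' (V_V h hV hl) (PP_anti d (Nat.zero_le l))).trans ?_
      rw [mul_assoc]
      refine (mul_le_mul' le_rfl hG).trans ?_
      exact FF_V h hV fun a ha => (mul_le_mul' le_rfl hB).trans (ihk a ha)
    · have : V l * PP D i V d l ≤ PP D i V (d+1) k := by
        simp only [PP]; exact le_iSup₂_of_le l hl le_rfl
      refine (mul_le_mul' le_rfl this).trans ?_
      conv_rhs => rw [PP]
      exact le_iSup₂_of_le k (Nat.zero_le k) le_rfl

lemma BB_le_PP : BB D i ≤ ⨆ d, PP D i V d 0 := by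
  have h1 : BB D i * (⨆ d, PP D i V d 0) ≤ ⨆ d, PP D i V d 0 := by
    refine BB_stable fun j hj => ?_
    rw [Submodule.mul_iSup]
    refine iSup_le fun d => ?_
    rcases Nat.eq_or_lt_of_le hj with rfl | hj
    · rw [← hV.v0]
      exact ((PP_main h hV d).2 0).trans (le_iSup (fun d => PP D i V d 0) (d+1))
    · exact ((mul_le_mul' (D_le_BB hj) le_rfl).trans (PP_main h hV d).1).trans
        (le_iSup (fun d => PP D i V d 0) d)
  refine le_trans ?_ h1
  calc BB D i = BB D i * 1 := (mul_one _).symm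
    _ ≤ _ := mul_le_mul' le_rfl ((one_le_BB (i+1)).trans (le_iSup (fun d => PP D i V d 0) 0))

end QASProof

namespace QASProof
open QAS

variable {A : Type} [Ring A] [Algebra ℂ A]

structure XSys (q : ℂ) (M : ℕ) (X : ℕ → ℤ → A) : Prop where
  r4 : ∀ i j m n, cc M i j = 0 → X i m * X j n = sgn M i j • (X j n * X i m)
  r5 : ∀ i j m n, cc M i j ≠ 0 →
    X i (m+1) * X j n - (q ^ cc M i j) • (X j n * X i (m+1)) =
      (q ^ cc M i j) • (X i m * X j (n+1)) - X j (n+1) * X i m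
  r6 : ∀ i j m n k, (cc M i j = 1 ∨ cc M i j = -1) → i ≠ M →
    brF q (X i m) (brF q⁻¹ (X i n) (X j k)) + brF q (X i n) (brF q⁻¹ (X i m) (X j k)) = 0
  r7 : ∀ m n k u, oscOf q M X m n k u + oscOf q M X m u k n = 0

/-! #### Cartan numbers -/

lemma cc_far {M i j : ℕ} (h : i + 2 ≤ j) : cc M j i = 0 := by
  unfold cc form4 innerE
  rw [if_neg (by omega), if_neg (by omega), if_neg (by omega), if_neg (by omega)]; rfl

lemma cc_up (M j : ℕ) : cc M j (j+1) = 1 ∨ cc M j (j+1) = -1 := by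
  unfold cc form4 innerE
  rw [if_neg (by omega), if_neg (by omega), if_pos rfl, if_neg (by omega)]
  unfold lof; split_ifs <;> simp

lemma cc_down (M j : ℕ) : cc M (j+1) j = 1 ∨ cc M (j+1) j = -1 := by
  unfold cc form4 innerE
  rw [if_neg (by omega), if_pos rfl, if_neg (by omega), if_neg (by omega)]
  unfold lof; split_ifs <;> simp

lemma cc_self {M j : ℕ} (h : j ≠ M) : cc M j j = 2 ∨ cc M j j = -2 := by
  unfold cc form4 innerE
  rw [if_pos rfl, if_neg (by omega), if_neg (by omega), if_pos rfl]
  unfold lof; split_ifs <;> first | omega | simp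

lemma cc_M (M : ℕ) : cc M M M = 0 := by
  unfold cc form4 innerE
  rw [if_pos rfl, if_neg (by omega), if_neg (by omega), if_pos rfl]
  unfold lof; simp

/-! #### mode shifting -/

lemma shift_pow {E : Type} [AddCommGroup E] [Module ℂ E] (f : ℤ → ℤ → E) (t : ℂ) (ht : t ≠ 0)
    (hf : ∀ a b, f (a+1) b = t • f a (b+1)) (n a b : ℤ) : f (a+n) b = t ^ n • f a (b+n) := by
  induction n using Int.induction_on generalizing a b with
  | zero => simp
  | succ n ih =>
    rw [← add_assoc, hf, ih, smul_smul, zpow_add_one₀ ht, mul_comm, add_right_comm, add_assoc]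
  | pred n ih =>
    have h1 := hf (a + (-(n:ℤ) - 1)) (b - 1)
    rw [show a + (-(n:ℤ) - 1) + 1 = a + -(n:ℤ) by ring, ih, sub_add_cancel] at h1
    rw [zpow_sub_one₀ ht, mul_comm, mul_smul, show b + (-(n:ℤ) - 1) = b - 1 + -(n:ℤ) by ring, h1,
      smul_smul, inv_mul_cancel₀ ht, one_smul]

lemma shift_sym {E : Type} [AddCommGroup E] [Module ℂ E] (f : ℤ → ℤ → E) (t : ℂ) (ht : t ≠ 0)
    (ht1 : ∀ n : ℤ, t ^ n ≠ -1)
    (hf : ∀ a b, f (a+1) b = t • f a (b+1)) (hs : ∀ a b, f a b + f b a = 0) (a b : ℤ) :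
    f a b = 0 := by
  have h1 := shift_pow f t ht hf (a - b) b b
  rw [add_sub_cancel] at h1
  have h2 := hs a b
  have h3 : f b a = - f a b := by rw [eq_neg_iff_add_eq_zero, add_comm]; exact h2
  rw [h3] at h1
  have h4 : (1 + t ^ (a-b)) • f a b = 0 := by
    rw [add_smul, one_smul]; nth_rewrite 1 [h1]; simp
  rcases smul_eq_zero.1 h4 with h5 | h5
  · exact absurd (by linear_combination h5) (ht1 (a-b))
  · exact h5

lemma q_zpow {q : ℂ} (hq0 : q ≠ 0) (hq1 : ∀ k : ℕ, k ≠ 0 → q ^ k ≠ 1) (n : ℤ) : q ^ n ≠ -1 := by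
  intro h
  have h2 : q ^ (2 * n) = 1 := by rw [mul_comm, zpow_mul, h]; norm_num
  rcases lt_trichotomy n 0 with hn | hn | hn
  · obtain ⟨k, hk⟩ := Int.eq_ofNat_of_zero_le (show 0 ≤ 2 * (-n) by omega)
    refine hq1 k (by omega) ?_
    rw [← zpow_natCast, ← hk, mul_neg, zpow_neg, h2, inv_one]
  · subst hn; norm_num at h
  · obtain ⟨k, hk⟩ := Int.eq_ofNat_of_zero_le (show 0 ≤ 2 * n by omega)
    refine hq1 k (by omega) ?_
    rw [← zpow_natCast, ← hk, h2]

section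
variable {q : ℂ} {M : ℕ} {X : ℕ → ℤ → A} (hX : XSys q M X)

/-- the span of the modes of the `i`-th current. -/
def DD (X : ℕ → ℤ → A) (i : ℕ) : Submodule ℂ A := Submodule.span ℂ (Set.range (X i))

lemma X_mem (i : ℕ) (n : ℤ) : X i n ∈ DD X i := Submodule.subset_span ⟨n, rfl⟩

lemma m2 (i j : ℕ) (a b : ℤ) : X i a * X j b ∈ DD X i * DD X j :=
  Submodule.mul_mem_mul (X_mem i a) (X_mem j b)

lemma m3 (i j k : ℕ) (a b c : ℤ) : X i a * (X j b * X k c) ∈ DD X i * (DD X j * DD X k) :=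
  Submodule.mul_mem_mul (X_mem i a) (m2 j k b c)

lemma m4 (i j k l : ℕ) (a b c d : ℤ) :
    X i a * (X j b * (X k c * X l d)) ∈ DD X i * (DD X j * (DD X k * DD X l)) :=
  Submodule.mul_mem_mul (X_mem i a) (m3 j k l b c d)

lemma le2 {i j : ℕ} {S : Submodule ℂ A} (h : ∀ a b, X i a * X j b ∈ S) :
    DD X i * DD X j ≤ S := by
  simp only [DD, Submodule.span_mul_span, Submodule.span_le]
  rintro _ ⟨_, ⟨a, rfl⟩, _, ⟨b, rfl⟩, rfl⟩
  exact h a b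

lemma le3 {i j k : ℕ} {S : Submodule ℂ A} (h : ∀ a b c, X i a * (X j b * X k c) ∈ S) :
    DD X i * (DD X j * DD X k) ≤ S := by
  simp only [DD, Submodule.span_mul_span, Submodule.span_le]
  rintro _ ⟨_, ⟨a, rfl⟩, _, ⟨_, ⟨b, rfl⟩, _, ⟨c, rfl⟩, rfl⟩, rfl⟩
  exact h a b c

lemma le4 {i j k l : ℕ} {S : Submodule ℂ A}
    (h : ∀ a b c d, X i a * (X j b * (X k c * X l d)) ∈ S) :
    DD X i * (DD X j * (DD X k * DD X l)) ≤ S := by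
  simp only [DD, Submodule.span_mul_span, Submodule.span_le]
  rintro _ ⟨_, ⟨a, rfl⟩, _, ⟨_, ⟨b, rfl⟩, _, ⟨_, ⟨c, rfl⟩, _, ⟨d, rfl⟩, rfl⟩, rfl⟩, rfl⟩
  exact h a b c d

include hX

lemma qshift {i j : ℕ} (hc : cc M i j ≠ 0) (S : Submodule ℂ A) (L R : A)
    (hS : ∀ a b, L * (X j a * X i b) * R ∈ S) (m n : ℤ) :
    S.mkQ (L * (X i (m+1) * X j n) * R) =
      (q ^ cc M i j) • S.mkQ (L * (X i m * X j (n+1)) * R) := by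
  rw [← map_smul, ← sub_eq_zero, ← map_sub, Submodule.mkQ_apply, Submodule.Quotient.mk_eq_zero]
  have h := hX.r5 i j m n hc
  have e : L * (X i (m+1) * X j n) * R - (q ^ cc M i j) • (L * (X i m * X j (n+1)) * R) =
      (q ^ cc M i j) • (L * (X j n * X i (m+1)) * R) - L * (X j (n+1) * X i m) * R := by
    have h' : X i (m+1) * X j n = (q ^ cc M i j) • (X j n * X i (m+1)) +
      ((q ^ cc M i j) • (X i m * X j (n+1)) - X j (n+1) * X i m) := by
      rw [← h]; abel
    rw [h']
    simp only [mul_add, mul_sub, add_mul, sub_mul, mul_smul_comm, smul_mul_assoc]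
    abel
  rw [e]
  exact S.sub_mem (S.smul_mem _ (hS _ _)) (hS _ _)

/-- symmetrised pairs of an even current span all pairs -/
lemma sym_zero (hq0 : q ≠ 0) (hq1 : ∀ k : ℕ, k ≠ 0 → q ^ k ≠ 1) {j : ℕ} (hj : j ≠ M)
    (S : Submodule ℂ A) (L R : A)
    (hS : ∀ a b, S.mkQ (L * (X j a * X j b) * R) + S.mkQ (L * (X j b * X j a) * R) = 0)
    (a b : ℤ) : S.mkQ (L * (X j a * X j b) * R) = 0 := by
  have hc : cc M j j ≠ 0 := by rcases cc_self hj with h | h <;> omega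
  have key : ∀ m n, S.mkQ (L * (X j (m+1) * X j n) * R) +
      S.mkQ (L * (X j (n+1) * X j m) * R) = q ^ cc M j j •
        (S.mkQ (L * (X j n * X j (m+1)) * R) + S.mkQ (L * (X j m * X j (n+1)) * R)) := by
    intro m n
    rw [← map_add, ← map_add, ← map_smul]
    congr 1
    have h := hX.r5 j j m n hc
    have h' : X j (m+1) * X j n + X j (n+1) * X j m = q ^ cc M j j •
        (X j n * X j (m+1) + X j m * X j (n+1)) := by
      rw [smul_add]
      have : X j (m+1) * X j n = (q ^ cc M j j) • (X j n * X j (m+1)) +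
        ((q ^ cc M j j) • (X j m * X j (n+1)) - X j (n+1) * X j m) := by
        rw [← h]; abel
      rw [this]; abel
    rw [← add_mul, ← mul_add, h', ← add_mul, ← mul_add, mul_smul_comm, smul_mul_assoc]
  refine shift_sym (fun a b => S.mkQ (L * (X j a * X j b) * R)) 1 one_ne_zero
    (fun n => by rw [one_zpow]; norm_num) ?_ hS a b
  intro m n
  simp only [one_smul]
  have k := key m n
  have e1 := hS (m+1) n
  have e2 := hS m (n+1)
  set P := S.mkQ (L * (X j (m+1) * X j n) * R)
  set P' := S.mkQ (L * (X j n * X j (m+1)) * R)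
  set Q := S.mkQ (L * (X j m * X j (n+1)) * R)
  set Q' := S.mkQ (L * (X j (n+1) * X j m) * R)
  have f1 : P' = -P := by rw [eq_neg_iff_add_eq_zero, add_comm]; exact e1
  have f2 : Q' = -Q := by rw [eq_neg_iff_add_eq_zero, add_comm]; exact e2
  rw [f1, f2] at k
  have k2 : (1 + q ^ cc M j j) • (P - Q) = 0 := by
    have : P - Q = - (q ^ cc M j j • (P - Q)) := by
      rw [← smul_neg, neg_sub, sub_eq_add_neg, k]; congr 1; abel
    rw [add_smul, one_smul]; nth_rewrite 1 [this]; simp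
  rcases smul_eq_zero.1 k2 with h5 | h5
  · exact absurd (by linear_combination h5) (q_zpow hq0 hq1 (cc M j j))
  · exact sub_eq_zero.1 h5

lemma serre' (hq0 : q ≠ 0) {i j : ℕ} (hc : cc M i j = 1 ∨ cc M i j = -1) (hi : i ≠ M)
    (m n k : ℤ) :
    X i m * (X i n * X j k) + X i n * (X i m * X j k)
      - (q + q⁻¹) • (X i m * (X j k * X i n) + X i n * (X j k * X i m))
      + (X j k * (X i n * X i m) + X j k * (X i m * X i n)) = 0 := by
  rw [← hX.r6 i j m n k hc hi]
  simp only [brF, mul_sub, sub_mul, mul_smul_comm, smul_mul_assoc, smul_sub, smul_smul,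
    mul_inv_cancel₀ hq0, one_smul, mul_assoc, smul_add, add_smul]
  abel

lemma osc' (hq0 : q ≠ 0) (m n k u : ℤ) :
    ∃ f : ℤ → ℤ → A, f = (fun n u =>
      X (M-1) m * (X M n * (X (M+1) k * X M u)) - q⁻¹ • (X M n * (X (M-1) m * (X (M+1) k * X M u)))
      - q • (X (M+1) k * (X (M-1) m * (X M n * X M u)))
      + X (M+1) k * (X M n * (X (M-1) m * X M u))
      + X M u * (X (M-1) m * (X M n * X (M+1) k)) - q⁻¹ • (X M u * (X M n * (X (M-1) m * X (M+1) k)))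
      - q • (X M u * (X (M+1) k * (X (M-1) m * X M n)))
      + X M u * (X (M+1) k * (X M n * X (M-1) m))) ∧ f n u + f u n = 0 := by
  refine ⟨_, rfl, ?_⟩
  rw [← hX.r7 m n k u]
  simp only [oscOf, brF, mul_sub, sub_mul, mul_smul_comm, smul_mul_assoc, smul_sub, smul_smul,
    mul_inv_cancel₀ hq0, inv_mul_cancel₀ hq0, one_smul, mul_assoc]
  abel

/-- `jjk` words -/
lemma jjk (hq0 : q ≠ 0) (hq1 : ∀ k : ℕ, k ≠ 0 → q ^ k ≠ 1) {j k : ℕ}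
    (hjk : cc M j k = 1 ∨ cc M j k = -1) :
    DD X j * (DD X j * DD X k) ≤ DD X j * (DD X k * DD X j) ⊔ DD X k * (DD X j * DD X j) := by
  refine le3 fun a b c => ?_
  set S := DD X j * (DD X k * DD X j) ⊔ DD X k * (DD X j * DD X j) with hSdef
  have s1 : ∀ a b c, X j a * (X k b * X j c) ∈ S := fun a b c =>
    (le_sup_left : _ ≤ S) (m3 _ _ _ _ _ _)
  have s2 : ∀ a b c, X k a * (X j b * X j c) ∈ S := fun a b c =>
    (le_sup_right : _ ≤ S) (m3 _ _ _ _ _ _)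
  rw [← Submodule.Quotient.mk_eq_zero, ← Submodule.mkQ_apply]
  by_cases hj : j = M
  · subst hj
    have anti : ∀ a b, X j a * X j b = - (X j b * X j a) := fun a b => by
      rw [hX.r4 j j a b (cc_M j)]; simp [sgn]
    have h1 := shift_pow (fun b c => S.mkQ (X j a * (X j b * X k c))) (q ^ cc j j k)
      (zpow_ne_zero _ hq0) (fun m n => by
        have := qshift hX (i := j) (j := k) (by omega) S (X j a) 1
          (fun _ _ => by rw [mul_one]; exact s1 _ _ _) m n
        simpa only [mul_one] using this) (b - a) a c
    simp only [add_sub_cancel] at h1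
    rw [h1]
    have h0 : X j a * X j a = 0 := by
      have := anti a a
      rw [eq_neg_iff_add_eq_zero, ← two_smul ℂ] at this
      simpa using this
    rw [← mul_assoc, h0]; simp
  · have := sym_zero hX hq0 hq1 hj S 1 (X k c) (fun m n => by
      rw [← map_add, Submodule.mkQ_apply, Submodule.Quotient.mk_eq_zero]
      simp only [one_mul, mul_assoc]
      have h := serre' hX hq0 hjk hj m n c
      have e : X j m * (X j n * X k c) + X j n * (X j m * X k c) =
        (q + q⁻¹) • (X j m * (X k c * X j n) + X j n * (X k c * X j m))
        - (X k c * (X j n * X j m) + X k c * (X j m * X j n)) := by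
        rw [← sub_eq_zero, ← h]; abel
      rw [e]
      exact S.sub_mem (S.smul_mem _ (S.add_mem (s1 _ _ _) (s1 _ _ _)))
        (S.add_mem (s2 _ _ _) (s2 _ _ _))) a b
    simpa only [one_mul, mul_assoc] using this

/-- `kjj` words -/
lemma kjj (hq0 : q ≠ 0) (hq1 : ∀ k : ℕ, k ≠ 0 → q ^ k ≠ 1) {j k : ℕ}
    (hjk : cc M j k = 1 ∨ cc M j k = -1) (hkj : cc M k j = 1 ∨ cc M k j = -1) :
    DD X k * (DD X j * DD X j) ≤ DD X j * (DD X k * DD X j) ⊔ DD X j * (DD X j * DD X k) := by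
  refine le3 fun c a b => ?_
  set S := DD X j * (DD X k * DD X j) ⊔ DD X j * (DD X j * DD X k) with hSdef
  have s1 : ∀ a b c, X j a * (X k b * X j c) ∈ S := fun a b c =>
    (le_sup_left : _ ≤ S) (m3 _ _ _ _ _ _)
  have s2 : ∀ a b c, X j a * (X j b * X k c) ∈ S := fun a b c =>
    (le_sup_right : _ ≤ S) (m3 _ _ _ _ _ _)
  rw [← Submodule.Quotient.mk_eq_zero, ← Submodule.mkQ_apply]
  by_cases hj : j = M
  · subst hj
    have anti : ∀ a b, X j a * X j b = - (X j b * X j a) := fun a b => by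
      rw [hX.r4 j j a b (cc_M j)]; simp [sgn]
    have h1 := shift_pow (fun c a => S.mkQ (X k c * (X j a * X j b))) (q ^ cc j k j)
      (zpow_ne_zero _ hq0) (fun m n => by
        have := qshift hX (i := k) (j := j) (by omega) S 1 (X j b)
          (fun _ _ => by rw [one_mul, mul_assoc]; exact s1 _ _ _) m n
        simpa only [one_mul, mul_assoc] using this) (b - a) (c - (b - a)) a
    simp only [add_sub_cancel, sub_add_cancel] at h1
    rw [h1]
    have h0 : X j b * X j b = 0 := by
      have := anti b b
      rw [eq_neg_iff_add_eq_zero, ← two_smul ℂ] at this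
      simpa using this
    rw [h0]; simp
  · have := sym_zero hX hq0 hq1 hj S (X k c) 1 (fun m n => by
      rw [← map_add, Submodule.mkQ_apply, Submodule.Quotient.mk_eq_zero]
      simp only [mul_one]
      have h := serre' hX hq0 hjk hj m n c
      have e : X k c * (X j m * X j n) + X k c * (X j n * X j m) =
        (q + q⁻¹) • (X j m * (X k c * X j n) + X j n * (X k c * X j m))
        - (X j m * (X j n * X k c) + X j n * (X j m * X k c)) := by
        rw [← sub_eq_zero, ← h]; abel
      rw [e]
      exact S.sub_mem (S.smul_mem _ (S.add_mem (s1 _ _ _) (s1 _ _ _)))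
        (S.add_mem (s2 _ _ _) (s2 _ _ _))) a b
    simpa only [mul_one] using this

omit hX in
lemma shift_sym3 {E : Type} [AddCommGroup E] [Module ℂ E] (hq0 : q ≠ 0)
    (hq1 : ∀ k : ℕ, k ≠ 0 → q ^ k ≠ 1) (r s : ℤ)
    (f : ℤ → ℤ → ℤ → E) (h1 : ∀ a b c, f (a+1) b c = q ^ r • f a (b+1) c)
    (h2 : ∀ a b c, f a (b+1) c = q ^ s • f a b (c+1))
    (h3 : ∀ a b c, f a b c + f c b a = 0) (a b c : ℤ) : f a b c = 0 := by
  refine shift_sym (fun a c => f a b c) (q ^ (r + s)) (zpow_ne_zero _ hq0) ?_ ?_ ?_ a c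
  · intro n; rw [← zpow_mul]; exact q_zpow hq0 hq1 _
  · intro a c
    rw [h1, h2, smul_smul, zpow_add₀ hq0]
  · intro a c; exact h3 a b c

/-- `jkj` words -/
lemma jkj (hq0 : q ≠ 0) (hq1 : ∀ k : ℕ, k ≠ 0 → q ^ k ≠ 1) {j k : ℕ} (hj : j ≠ M)
    (hjk : cc M j k = 1 ∨ cc M j k = -1) (hkj : cc M k j = 1 ∨ cc M k j = -1) :
    DD X j * (DD X k * DD X j) ≤ DD X j * (DD X j * DD X k) ⊔ DD X k * (DD X j * DD X j) := by
  refine le3 fun a b c => ?_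
  set S := DD X j * (DD X j * DD X k) ⊔ DD X k * (DD X j * DD X j) with hSdef
  have s1 : ∀ a b c, X j a * (X j b * X k c) ∈ S := fun a b c =>
    (le_sup_left : _ ≤ S) (m3 _ _ _ _ _ _)
  have s2 : ∀ a b c, X k a * (X j b * X j c) ∈ S := fun a b c =>
    (le_sup_right : _ ≤ S) (m3 _ _ _ _ _ _)
  rw [← Submodule.Quotient.mk_eq_zero, ← Submodule.mkQ_apply]
  refine shift_sym3 hq0 hq1 (cc M j k) (cc M k j)
    (fun a b c => S.mkQ (X j a * (X k b * X j c))) ?_ ?_ ?_ a b c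
  · intro a b c
    have := qshift hX (i := j) (j := k) (by omega) S 1 (X j c)
          (fun _ _ => by rw [one_mul, mul_assoc]; exact s2 _ _ _) a b
    simpa only [one_mul, mul_assoc] using this
  · intro a b c
    have := qshift hX (i := k) (j := j) (by omega) S (X j a) 1
          (fun _ _ => by rw [mul_one]; exact s1 _ _ _) b c
    simpa only [mul_one] using this
  · intro m p n
    have h := serre' hX hq0 hjk hj m n p
    have e : (q + q⁻¹) • (X j m * (X k p * X j n) + X j n * (X k p * X j m)) =
        (X j m * (X j n * X k p) + X j n * (X j m * X k p)) +
        (X k p * (X j n * X j m) + X k p * (X j m * X j n)) := by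
        rw [← sub_eq_zero, ← neg_eq_zero, ← h]; abel
    have hq : q + q⁻¹ ≠ 0 := by
      intro h0
      have h2 : q ^ (2:ℤ) = -1 := by
        have h3 : q * (q + q⁻¹) = 0 := by rw [h0, mul_zero]
        rw [mul_add, mul_inv_cancel₀ hq0] at h3
        rw [zpow_ofNat]; linear_combination h3
      exact q_zpow hq0 hq1 2 h2
    rw [← map_add, Submodule.mkQ_apply, Submodule.Quotient.mk_eq_zero,
      ← Submodule.smul_mem_iff S hq, e]
    exact S.add_mem (S.add_mem (s1 _ _ _) (s1 _ _ _)) (S.add_mem (s2 _ _ _) (s2 _ _ _))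

lemma far {i j : ℕ} (hij : i + 2 ≤ j) (m n : ℤ) : X j m * X i n = X i n * X j m := by
  rw [hX.r4 j i m n (cc_far hij), sgn, if_neg (by omega), one_smul]

lemma osc_a (hq0 : q ≠ 0) (hq1 : ∀ k : ℕ, k ≠ 0 → q ^ k ≠ 1) {j : ℕ} (hj : j + 1 = M) :
    DD X (j+1) * (DD X (j+2) * (DD X (j+1) * DD X j)) ≤
    (DD X j * (DD X (j+1) * (DD X (j+2) * DD X (j+1))) ⊔ DD X j * (DD X (j+2) * (DD X (j+1) * DD X (j+1))) ⊔
      DD X (j+1) * (DD X j * (DD X (j+2) * DD X (j+1))) ⊔ DD X (j+1) * (DD X j * (DD X (j+1) * DD X (j+2))) ⊔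
      DD X (j+1) * (DD X (j+1) * (DD X j * DD X (j+2))) ⊔ DD X (j+2) * (DD X (j+1) * (DD X (j+1) * DD X j))) ⊔
      DD X (j+2) * (DD X (j+1) * (DD X j * DD X (j+1))) := by
  subst hj
  generalize hS : (_ ⊔ _ : Submodule ℂ A) = S
  obtain ⟨⟨⟨⟨⟨⟨t1, t2⟩, t3⟩, t4⟩, t5⟩, t6⟩, t7⟩ := by
    have := hS.le; simpa only [sup_le_iff] using this
  have s1 := fun a b c d => t1 (m4 (X := X) _ _ _ _ a b c d)
  have s2 := fun a b c d => t2 (m4 (X := X) _ _ _ _ a b c d)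
  have s3 := fun a b c d => t3 (m4 (X := X) _ _ _ _ a b c d)
  have s4 := fun a b c d => t4 (m4 (X := X) _ _ _ _ a b c d)
  have s5 := fun a b c d => t5 (m4 (X := X) _ _ _ _ a b c d)
  have s6 := fun a b c d => t6 (m4 (X := X) _ _ _ _ a b c d)
  have s7 := fun a b c d => t7 (m4 (X := X) _ _ _ _ a b c d)
  clear t1 t2 t3 t4 t5 t6 t7
  have hca : ∀ m n, X (j+2) m * X j n = X j n * X (j+2) m := fun m n => far hX (by omega) m n
  have hca' : ∀ m n z, X (j+2) m * (X j n * z) = X j n * (X (j+2) m * z) := fun m n z => by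
    rw [← mul_assoc, hca, mul_assoc]
  have c1 : cc (j+1) (j+1) (j+2) = 1 ∨ cc (j+1) (j+1) (j+2) = -1 := cc_up (j+1) (j+1)
  have c2 : cc (j+1) (j+2) (j+1) = 1 ∨ cc (j+1) (j+2) (j+1) = -1 := cc_down (j+1) (j+1)
  refine le4 fun u k n m => ?_
  rw [← Submodule.Quotient.mk_eq_zero, ← Submodule.mkQ_apply]
  refine shift_sym3 hq0 hq1 (cc (j+1) (j+1) (j+2)) (cc (j+1) (j+2) (j+1))
    (fun a b c => S.mkQ (X (j+1) a * (X (j+2) b * (X (j+1) c * X j m)))) ?_ ?_ ?_ u k n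
  · intro a b c
    have := qshift hX (i := j+1) (j := j+2) (by omega) S 1 (X (j+1) c * X j m)
          (fun _ _ => by rw [one_mul, mul_assoc]; exact s6 _ _ _ _) a b
    simpa only [one_mul, mul_assoc] using this
  · intro a b c
    have := qshift hX (i := j+2) (j := j+1) (by omega) S (X (j+1) a) (X j m)
          (fun _ _ => by simp only [mul_assoc, hca]; exact s5 _ _ _ _) b c
    simpa only [mul_assoc] using this
  · intro u k n
    rw [← map_add, Submodule.mkQ_apply, Submodule.Quotient.mk_eq_zero]
    obtain ⟨f, hf, h⟩ := osc' hX hq0 m n k u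
    have hw : ∀ n u, f n u - X (j+1) u * (X (j+2) k * (X (j+1) n * X j m)) ∈ S := by
      intro n u
      rw [hf]
      simp only [Nat.add_sub_cancel, add_sub_cancel_right, show j + 1 + 1 = j + 2 from rfl,
        hca, hca']
      exact S.sub_mem (S.sub_mem (S.add_mem (S.add_mem (S.sub_mem (S.sub_mem (s1 _ _ _ _)
        (S.smul_mem _ (s3 _ _ _ _))) (S.smul_mem _ (s2 _ _ _ _))) (s7 _ _ _ _)) (s4 _ _ _ _))
        (S.smul_mem _ (s5 _ _ _ _))) (S.smul_mem _ (s3 _ _ _ _))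
    have := S.neg_mem (S.add_mem (hw n u) (hw u n))
    convert this using 1
    have h' : f n u = - f u n := by rw [eq_neg_iff_add_eq_zero]; exact h
    rw [h']; abel

lemma osc_b (hq0 : q ≠ 0) (hq1 : ∀ k : ℕ, k ≠ 0 → q ^ k ≠ 1) {j : ℕ} (hj : j + 1 = M) :
    DD X (j+2) * (DD X (j+1) * (DD X j * DD X (j+1))) ≤
    (DD X j * (DD X (j+1) * (DD X (j+2) * DD X (j+1))) ⊔ DD X j * (DD X (j+2) * (DD X (j+1) * DD X (j+1))) ⊔
      DD X (j+1) * (DD X j * (DD X (j+2) * DD X (j+1))) ⊔ DD X (j+1) * (DD X j * (DD X (j+1) * DD X (j+2))) ⊔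
      DD X (j+1) * (DD X (j+1) * (DD X j * DD X (j+2))) ⊔ DD X (j+2) * (DD X (j+1) * (DD X (j+1) * DD X j))) ⊔
      DD X (j+1) * (DD X (j+2) * (DD X (j+1) * DD X j)) := by
  subst hj
  generalize hS : (_ ⊔ _ : Submodule ℂ A) = S
  obtain ⟨⟨⟨⟨⟨⟨t1, t2⟩, t3⟩, t4⟩, t5⟩, t6⟩, t7⟩ := by
    have := hS.le; simpa only [sup_le_iff] using this
  have s1 := fun a b c d => t1 (m4 (X := X) _ _ _ _ a b c d)
  have s2 := fun a b c d => t2 (m4 (X := X) _ _ _ _ a b c d)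
  have s3 := fun a b c d => t3 (m4 (X := X) _ _ _ _ a b c d)
  have s4 := fun a b c d => t4 (m4 (X := X) _ _ _ _ a b c d)
  have s5 := fun a b c d => t5 (m4 (X := X) _ _ _ _ a b c d)
  have s6 := fun a b c d => t6 (m4 (X := X) _ _ _ _ a b c d)
  have s7 := fun a b c d => t7 (m4 (X := X) _ _ _ _ a b c d)
  clear t1 t2 t3 t4 t5 t6 t7
  have hca : ∀ m n, X (j+2) m * X j n = X j n * X (j+2) m := fun m n => far hX (by omega) m n
  have hca' : ∀ m n z, X (j+2) m * (X j n * z) = X j n * (X (j+2) m * z) := fun m n z => by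
    rw [← mul_assoc, hca, mul_assoc]
  have c1 := cc_down (j+1) j
  have c2 := cc_up (j+1) j
  refine le4 fun k u m n => ?_
  rw [← Submodule.Quotient.mk_eq_zero, ← Submodule.mkQ_apply]
  refine shift_sym3 hq0 hq1 (cc (j+1) (j+1) j) (cc (j+1) j (j+1))
    (fun a b c => S.mkQ (X (j+2) k * (X (j+1) a * (X j b * X (j+1) c)))) ?_ ?_ ?_ u m n
  · intro a b c
    have := qshift hX (i := j+1) (j := j) (by omega) S (X (j+2) k) (X (j+1) c)
          (fun _ _ => by simp only [mul_assoc, hca']; exact s2 _ _ _ _) a b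
    simpa only [mul_assoc] using this
  · intro a b c
    have := qshift hX (i := j) (j := j+1) (by omega) S (X (j+2) k * X (j+1) a) 1
          (fun _ _ => by simp only [mul_assoc, mul_one]; exact s6 _ _ _ _) b c
    simpa only [mul_assoc, mul_one] using this
  · intro n m u
    rw [← map_add, Submodule.mkQ_apply, Submodule.Quotient.mk_eq_zero]
    obtain ⟨f, hf, h⟩ := osc' hX hq0 m n k u
    have hw : ∀ n u, f n u - X (j+2) k * (X (j+1) n * (X j m * X (j+1) u)) ∈ S := by
      intro n u
      rw [hf]
      simp only [Nat.add_sub_cancel, add_sub_cancel_right, show j + 1 + 1 = j + 2 from rfl,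
        hca, hca']
      have := S.add_mem (S.sub_mem (S.sub_mem (S.add_mem (S.sub_mem (S.sub_mem (s1 m n k u)
        (S.smul_mem q⁻¹ (s3 n m k u))) (S.smul_mem q (s2 m k n u))) (s4 u m n k))
        (S.smul_mem q⁻¹ (s5 u n m k))) (S.smul_mem q (s3 u m k n))) (s7 u k n m)
      convert this using 1
      abel
    have := S.neg_mem (S.add_mem (hw n u) (hw u n))
    convert this using 1
    have h' : f n u = - f u n := by rw [eq_neg_iff_add_eq_zero]; exact h
    rw [h']; abel

end
end QASProof

namespace QASProof
open QAS

section
variable {A : Type} [Ring A] [Algebra ℂ A] {q : ℂ} {M : ℕ} {X : ℕ → ℤ → A}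

theorem dsys (hX : XSys q M X) (hq0 : q ≠ 0) (hq1 : ∀ k : ℕ, k ≠ 0 → q ^ k ≠ 1) :
    DSys (DD X) (fun i => X i 0) := by
  have h1 : ∀ i j, i + 2 ≤ j → DD X j * DD X i = DD X i * DD X j := fun i j h =>
    le_antisymm (le2 fun a b => by rw [far hX h]; exact m2 _ _ _ _)
      (le2 fun a b => by rw [← far hX h]; exact m2 _ _ _ _)
  refine ⟨fun k => X_mem _ _, h1, fun j => jjk hX hq0 hq1 (cc_down M j),
    fun j => kjj hX hq0 hq1 (cc_up M j) (cc_down M j), fun j => ?_, fun j => ?_, fun j => ?_⟩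
  · by_cases hj : j + 1 = M
    · exact osc_a hX hq0 hq1 hj
    · have h := jkj hX hq0 hq1 hj (cc_up M (j+1)) (cc_down M (j+1))
      have e : DD X (j+1) * (DD X (j+2) * (DD X (j+1) * DD X j)) =
          (DD X (j+1) * (DD X (j+2) * DD X (j+1))) * DD X j := by simp only [mul_assoc]
      rw [e]
      refine (mul_le_mul_left h (DD X j)).trans ?_
      rw [Submodule.sup_mul]
      simp only [mul_assoc, show j + 1 + 1 = j + 2 from rfl]
      rw [h1 j (j+2) le_rfl]
      refine sup_le ?_ ?_
      · exact le_sup_of_le_left (le_sup_of_le_left le_sup_right)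
      · exact le_sup_of_le_left le_sup_right
  · by_cases hj : j + 1 = M
    · exact osc_b hX hq0 hq1 hj
    · have h := jkj hX hq0 hq1 hj (cc_down M j) (cc_up M j)
      refine (mul_le_mul_right h (DD X (j+2))).trans ?_
      rw [Submodule.mul_sup]
      refine sup_le ?_ ?_
      · exact le_sup_of_le_left le_sup_right
      · rw [← mul_assoc, h1 j (j+2) le_rfl, mul_assoc]
        exact le_sup_of_le_left (le_sup_of_le_left (le_sup_of_le_left (le_sup_of_le_left
          (le_sup_of_le_left le_sup_right))))
  · refine le2 fun a b => ?_
    set S := Submodule.span ℂ {X (j+1) 0} * DD X j ⊔ DD X j * DD X (j+1) with hS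
    rw [← Submodule.Quotient.mk_eq_zero, ← Submodule.mkQ_apply]
    have hc : cc M (j+1) j ≠ 0 := by rcases cc_down M j with h | h <;> omega
    have h1 := shift_pow (fun a b => S.mkQ (X (j+1) a * X j b)) (q ^ cc M (j+1) j)
      (zpow_ne_zero _ hq0) (fun m n => by
        have := qshift hX hc S 1 1
          (fun _ _ => by rw [mul_one, one_mul]; exact (le_sup_right : _ ≤ S) (m2 _ _ _ _)) m n
        simpa only [mul_one, one_mul] using this) a 0 b
    simp only [zero_add] at h1
    have h2 : S.mkQ (X (j+1) 0 * X j (b+a)) = 0 := by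
      rw [Submodule.mkQ_apply, Submodule.Quotient.mk_eq_zero]
      exact (le_sup_left : _ ≤ S) (Submodule.mul_mem_mul (Submodule.mem_span_singleton_self _)
        (X_mem _ _))
    rw [h1, h2, smul_zero]

end

section
variable {q : ℂ} {M N : ℕ}

lemma XpA_pos {i : ℕ} (h : 1 ≤ i ∧ i ≤ M + N - 1) (n : ℤ) :
    XpA q M N false 3 i n = mkA q M N false 3 (gi (Gen.Xp ⟨i, h⟩ n)) := by
  rw [XpA, XpF, dif_pos h]

lemma XpA_neg {i : ℕ} (h : ¬ (1 ≤ i ∧ i ≤ M + N - 1)) (n : ℤ) :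
    XpA q M N false 3 i n = 0 := by
  rw [XpA, XpF, dif_neg h, map_zero]

lemma mk_rel {a b : FA M N false} (h : rel q M N false 3 a b) :
    mkA q M N false 3 a = mkA q M N false 3 b := RingQuot.mkAlgHom_rel ℂ h

lemma mk_br (u : ℂ) (a b : FA M N false) : mkA q M N false 3 (brF u a b) =
    brF u (mkA q M N false 3 a) (mkA q M N false 3 b) := by
  simp only [brF, map_sub, map_mul, map_smul]

lemma xsys (hM : 1 ≤ M) (hN : 1 ≤ N) : XSys q M (XpA q M N false 3) := by
  refine ⟨fun i j m n h => ?_, fun i j m n h => ?_, fun i j m n k h hi => ?_, fun m n k u => ?_⟩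
  · by_cases h1 : 1 ≤ i ∧ i ≤ M + N - 1
    · by_cases h2 : 1 ≤ j ∧ j ≤ M + N - 1
      · have := mk_rel (rel.XX0p (q := q) (M := M) (N := N) (ext := false) (lvl := 3)
          ⟨i, h1⟩ ⟨j, h2⟩ m n (by norm_num) h)
        rw [map_sub, map_smul, map_mul, map_mul, map_zero, sub_eq_zero] at this
        rw [XpA_pos h1, XpA_pos h2]; exact this
      · simp only [XpA_neg h2, mul_zero, zero_mul, smul_zero]
    · simp only [XpA_neg h1, mul_zero, zero_mul, smul_zero]
  · by_cases h1 : 1 ≤ i ∧ i ≤ M + N - 1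
    · by_cases h2 : 1 ≤ j ∧ j ≤ M + N - 1
      · have := mk_rel (rel.XXp (q := q) (M := M) (N := N) (ext := false) (lvl := 3)
          ⟨i, h1⟩ ⟨j, h2⟩ m n (by norm_num) h)
        simp only [map_sub, map_smul, map_mul] at this
        simp only [XpA_pos h1, XpA_pos h2]; exact this
      · simp only [XpA_neg h2, mul_zero, zero_mul, smul_zero]
    · simp only [XpA_neg h1, mul_zero, zero_mul, smul_zero]
  · by_cases h1 : 1 ≤ i ∧ i ≤ M + N - 1
    · by_cases h2 : 1 ≤ j ∧ j ≤ M + N - 1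
      · have := mk_rel (rel.serreP (q := q) (M := M) (N := N) (ext := false) (lvl := 3)
          ⟨i, h1⟩ ⟨j, h2⟩ m n k le_rfl h hi)
        simp only [map_add, mk_br, map_zero] at this
        simp only [XpA_pos h1, XpA_pos h2]; exact this
      · simp only [XpA_neg h2, brF, mul_zero, zero_mul, smul_zero, sub_zero, add_zero]
    · simp only [XpA_neg h1, brF, mul_zero, zero_mul, smul_zero, sub_zero, add_zero]
  · by_cases h1 : 1 < M
    · by_cases h2 : 1 < N
      · have := mk_rel (rel.oscP (q := q) (M := M) (N := N) (ext := false) (lvl := 3)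
          m n k u le_rfl h1 h2)
        simp only [oscOf, map_add, map_mul, mk_br, map_zero] at this
        exact this
      · have h3 : ¬ (1 ≤ M + 1 ∧ M + 1 ≤ M + N - 1) := by omega
        simp only [oscOf, XpA_neg h3, brF, mul_zero, zero_mul, smul_zero, sub_zero, add_zero]
    · have h3 : ¬ (1 ≤ M - 1 ∧ M - 1 ≤ M + N - 1) := by omega
      simp only [oscOf, XpA_neg h3, brF, mul_zero, zero_mul, smul_zero, sub_zero, add_zero]

/-- the span of the root vectors of `α_i + ⋯ + α_{i+k}` -/
def VV (q : ℂ) (M N i k : ℕ) : Submodule ℂ (ALG q M N false 3) :=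
  Submodule.span ℂ (Set.range (Xroot q M N false 3 i k))

lemma vsys (hq0 : q ≠ 0) (i : ℕ) :
    VSys (DD (XpA q M N false 3)) (fun i => XpA q M N false 3 i 0) i (VV q M N i) := by
  have hu : ∀ k, qpar q M k ≠ 0 := fun k => zpow_ne_zero _ hq0
  have e : ∀ k n, Xroot q M N false 3 i (k+1) n = Xroot q M N false 3 i k n *
      XpA q M N false 3 (i+k+1) 0 - qpar q M (i+k+1) • (XpA q M N false 3 (i+k+1) 0 *
      Xroot q M N false 3 i k n) := fun k n => rfl
  have mem : ∀ k n, Xroot q M N false 3 i k n ∈ VV q M N i k := fun k n =>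
    Submodule.subset_span ⟨n, rfl⟩
  refine ⟨rfl, fun k => ?_, fun k => ?_⟩
  · rw [VV, Submodule.span_le]
    rintro _ ⟨n, rfl⟩
    rw [e]
    refine Submodule.sub_mem _ (Submodule.mem_sup_left ?_)
      (Submodule.mem_sup_right (Submodule.smul_mem _ _ ?_))
    · exact Submodule.mul_mem_mul (mem _ _) (Submodule.mem_span_singleton_self _)
    · exact Submodule.mul_mem_mul (Submodule.mem_span_singleton_self _) (mem _ _)
  · nth_rewrite 1 [VV]
    rw [Submodule.span_mul_span, Submodule.span_le]
    rintro _ ⟨_, rfl, _, ⟨n, rfl⟩, rfl⟩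
    have e2 : XpA q M N false 3 (i+k+1) 0 * Xroot q M N false 3 i k n =
      (qpar q M (i+k+1))⁻¹ • (Xroot q M N false 3 i k n * XpA q M N false 3 (i+k+1) 0
        - Xroot q M N false 3 i (k+1) n) := by
      rw [e, sub_sub_cancel, smul_smul, inv_mul_cancel₀ (hu _), one_smul]
    change XpA q M N false 3 (i+k+1) 0 * Xroot q M N false 3 i k n ∈ _
    rw [e2]
    refine Submodule.smul_mem _ _ (Submodule.sub_mem _ (Submodule.mem_sup_right ?_)
      (Submodule.mem_sup_left (mem _ _)))
    exact Submodule.mul_mem_mul (mem _ _) (Submodule.mem_span_singleton_self _)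

lemma Xroot_zero {i k : ℕ} (h : M + N - 1 < i + k) (n : ℤ) : Xroot q M N false 3 i k n = 0 := by
  cases k with
  | zero => exact XpA_neg (by omega) n
  | succ k =>
    rw [Xroot, XpA_neg (by omega), brF, mul_zero, zero_mul, smul_zero, sub_zero]

/-- span of the ordered monomials in roots `≥ (i,j)`. -/
def WW (q : ℂ) (M N i j : ℕ) : Submodule ℂ (ALG q M N false 3) :=
  Submodule.span ℂ {x | ∃ L : List ((ℕ × ℕ) × ℤ),
      (∀ p ∈ L, 1 ≤ p.1.1 ∧ p.1.1 ≤ p.1.2 ∧ p.1.2 ≤ M + N - 1) ∧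
      L.Chain' (fun a b => rootLE a.1 b.1) ∧ (∀ p ∈ L, rootLE (i, j) p.1) ∧
      x = (L.map fun p => XrootIJ q M N false 3 p.1.1 p.1.2 p.2).prod}

lemma rootLE_trans {a b c : ℕ × ℕ} (h1 : rootLE a b) (h2 : rootLE b c) : rootLE a c := by
  unfold rootLE at *; omega

lemma WW_anti {i j i' j' : ℕ} (h : rootLE (i, j) (i', j')) : WW q M N i' j' ≤ WW q M N i j := by
  refine Submodule.span_mono ?_
  rintro x ⟨L, h1, h2, h3, h4⟩
  exact ⟨L, h1, h2, fun p hp => rootLE_trans h (h3 p hp), h4⟩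

lemma one_le_WW (i j : ℕ) : 1 ≤ WW q M N i j := by
  rw [Submodule.one_le]
  exact Submodule.subset_span ⟨[], by simp, List.isChain_nil, by simp, by simp⟩

lemma VV_WW {i a : ℕ} (hi : 1 ≤ i) : VV q M N i a * WW q M N i (i+a) ≤ WW q M N i (i+a) := by
  conv_lhs => rw [VV, WW]
  rw [Submodule.span_mul_span, Submodule.span_le]
  rintro _ ⟨_, ⟨n, rfl⟩, _, ⟨L, h1, h2, h3, rfl⟩, rfl⟩
  by_cases h : M + N - 1 < i + a
  · simp only [Xroot_zero h, zero_mul]; exact Submodule.zero_mem _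
  · refine Submodule.subset_span ⟨((i, i+a), n) :: L, ?_, ?_, ?_, ?_⟩
    · intro p hp
      rcases List.mem_cons.1 hp with rfl | hp
      · exact ⟨hi, by simp, by simpa using h⟩
      · exact h1 p hp
    · refine List.isChain_cons.2 ⟨fun y hy => h3 y (List.mem_of_mem_head? hy), h2⟩
    · intro p hp
      rcases List.mem_cons.1 hp with rfl | hp
      · exact Or.inr ⟨rfl, le_rfl⟩
      · exact h3 p hp
    · rw [List.map_cons, List.prod_cons]
      simp only [XrootIJ, add_tsub_cancel_left]

lemma PP_WW {i : ℕ} (hi : 1 ≤ i) (hB : BB (DD (XpA q M N false 3)) (i+1) ≤ WW q M N (i+1) 0)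
    (d k : ℕ) : PP (DD (XpA q M N false 3)) i (VV q M N i) d k ≤ WW q M N i (i+k) := by
  induction d generalizing k with
  | zero => exact hB.trans (WW_anti (Or.inl (Nat.lt_succ_self i)))
  | succ d ih =>
    simp only [PP]
    refine iSup_le fun a => iSup_le fun ha => ?_
    refine (mul_le_mul_right (ih a) _).trans ((VV_WW hi).trans (WW_anti (Or.inr ⟨rfl, ?_⟩)))
    simpa using ha

lemma BB_WW (hq0 : q ≠ 0) (hq1 : ∀ k : ℕ, k ≠ 0 → q ^ k ≠ 1) (hM : 1 ≤ M) (hN : 1 ≤ N)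
    (m i : ℕ) (hi : 1 ≤ i) (hm : M + N ≤ i + m) :
    BB (DD (XpA q M N false 3)) i ≤ WW q M N i 0 := by
  induction m generalizing i with
  | zero =>
    refine le_trans ?_ (one_le_WW i 0)
    rw [BB, ← Algebra.toSubmodule_bot]
    refine Subalgebra.toSubmodule.monotone (Algebra.adjoin_le ?_)
    rintro y ⟨j, hj, hy⟩
    have : DD (XpA q M N false 3) j ≤ ⊥ := by
      rw [DD, Submodule.span_le]
      rintro _ ⟨n, rfl⟩
      rw [XpA_neg (by omega)]; exact Submodule.zero_mem _
    rw [(Submodule.mem_bot ℂ).1 (this hy)]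
    exact zero_mem _
  | succ m ih =>
    have hB := ih (i+1) (by omega) (by omega)
    refine (BB_le_PP (dsys (xsys hM hN) hq0 hq1) (vsys hq0 i)).trans (iSup_le fun d => ?_)
    exact (PP_WW hi hB d 0).trans (WW_anti (Or.inr ⟨rfl, Nat.zero_le _⟩))

lemma Xroot_mem (i k : ℕ) (n : ℤ) : Xroot q M N false 3 i k n ∈ Aplus q M N false 3 := by
  have hx : ∀ i n, XpA q M N false 3 i n ∈ Aplus q M N false 3 := fun i n =>
    Algebra.subset_adjoin ⟨i, n, rfl⟩
  induction k with
  | zero => exact hx i n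
  | succ k ih =>
    rw [Xroot, brF]
    exact Subalgebra.sub_mem _ (Subalgebra.mul_mem _ ih (hx _ _))
      (Subalgebra.smul_mem _ (Subalgebra.mul_mem _ (hx _ _) ih) _)

end
end QASProof

open QAS in
/-- Theorem 3.7, PBW spanning: `U⁺` is spanned over `ℂ` by the ordered
monomials in the root vectors `X_β(n)`, the factors appearing in weakly increasing order
of `β ∈ Δ`. -/
theorem pbw_spanning (q : ℂ) (hq0 : q ≠ 0)
    (hq1 : ∀ k : ℕ, k ≠ 0 → q ^ k ≠ 1) (M N : ℕ) (hM : 1 ≤ M) (hN : 1 ≤ N) :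
    Submodule.span ℂ (pbwSet q M N false 3) =
      Subalgebra.toSubmodule (Aplus q M N false 3) := by
  apply le_antisymm
  · rw [Submodule.span_le]
    rintro x ⟨L, -, -, rfl⟩
    refine Subalgebra.list_prod_mem _ ?_
    intro y hy
    obtain ⟨p, -, rfl⟩ := List.mem_map.1 hy
    exact QASProof.Xroot_mem _ _ _
  · have h1 : Subalgebra.toSubmodule (Aplus q M N false 3) ≤
        QASProof.BB (QASProof.DD (XpA q M N false 3)) 1 := by
      refine Subalgebra.toSubmodule.monotone (Algebra.adjoin_le ?_)
      rintro _ ⟨i, n, rfl⟩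
      by_cases hi : 1 ≤ i
      · exact Algebra.subset_adjoin ⟨i, hi, QASProof.X_mem i n⟩
      · rw [QASProof.XpA_neg (by omega)]
        exact zero_mem _
    refine h1.trans ((QASProof.BB_WW hq0 hq1 hM hN (M + N) 1 le_rfl (by omega)).trans ?_)
    refine Submodule.span_mono ?_
    rintro x ⟨L, h1, h2, -, h4⟩
    exact ⟨L, h1, h2, h4⟩
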